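/- arXiv:1602.02234 — 8 statements merged into one kernel-verified Lean document; each statement's English description precedes it below -/
import Mathlib

section
/- Let A be an Artin algebra, and let T, M be finitely generated right A-modules such that ^⊥T = add M, where ^⊥T = {X ∈ mod A : Ext^i_A(X, T) = 0 for all i ≥ 1}. Let B = End_A(M). Then for every integer r ≥ 2, if the global dimension of B is at most r, then the injective dimension of T is at most r. -/
open CategoryTheory

universe u

namespace Stmt2Aux

open Abelian

/-- Baer criterion for higher Ext: vanishing on finite modules implies vanishing everywhere. -/
lemma ext_vanish_of_finite (S : Type u) [Ring S] [HasExt.{u} (ModuleCat.{u} S)] (n : ℕ) :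
    ∀ Y : ModuleCat.{u} S,
      (∀ X : ModuleCat.{u} S, Module.Finite S X → Subsingleton (Ext X Y (n + 1))) →
      ∀ X : ModuleCat.{u} S, Subsingleton (Ext X Y (n + 1)) := by
  induction n with
  | zero =>
    intro Y h
    have hB : Module.Baer S Y := by
      intro I g
      have hex : ((Submodule.mkQ I).shortComplexKer).ShortExact :=
        LinearMap.shortExact_shortComplexKer (Submodule.mkQ_surjective I)
      have hI : LinearMap.ker (Submodule.mkQ I) = I := Submodule.ker_mkQ I
      let e : LinearMap.ker (Submodule.mkQ I) ≃ₗ[S] I := LinearEquiv.ofEq _ _ hI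
      have hs : Subsingleton (Ext (ModuleCat.of S (S ⧸ I)) Y 1) := h _ inferInstance
      obtain ⟨φ, hφ⟩ := Ext.contravariant_sequence_exact₁ hex Y
        (Ext.mk₀ (ModuleCat.ofHom (g ∘ₗ e.toLinearMap))) (add_zero 1)
        (hs.elim _ _)
      obtain ⟨ψ, rfl⟩ := Ext.homEquiv₀.symm.surjective φ
      rw [Ext.homEquiv₀_symm_apply, Ext.mk₀_comp_mk₀] at hφ
      have h2 := (Ext.mk₀_bijective _ _).injective hφ
      refine ⟨ψ.hom, fun x hx => ?_⟩
      have h3 := congrArg (fun f => f.hom ⟨x, hI.symm ▸ hx⟩) h2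
      exact h3
    have hinj : Injective Y :=
      Module.injective_object_of_injective_module (inj := hB.injective)
    intro X
    exact HasInjectiveDimensionLT.subsingleton Y 1 1 le_rfl X
  | succ n ih =>
    intro Y h X
    obtain ⟨I, inj, f, monof⟩ := (inferInstance : EnoughInjectives (ModuleCat.{u} S)).1 Y
    let T := ShortComplex.mk f (Limits.cokernel.π f) (Limits.cokernel.condition f)
    have hT : T.ShortExact := { exact := ShortComplex.exact_cokernel f }
    have hinj : Injective T.X₂ := inj
    have hQ : ∀ X : ModuleCat.{u} S, Subsingleton (Ext X T.X₃ (n + 1)) := by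
      apply ih
      intro X hX
      have hXY : Subsingleton (Ext X T.X₁ (n + 1 + 1)) := h X hX
      refine subsingleton_of_forall_eq 0 fun x => ?_
      obtain ⟨y, rfl⟩ := Ext.covariant_sequence_exact₃ X hT x rfl (hXY.elim _ _)
      rw [Ext.eq_zero_of_injective y, Ext.zero_comp]
    refine subsingleton_of_forall_eq 0 fun x => ?_
    obtain ⟨y, hy⟩ := Ext.covariant_sequence_exact₁ X hT (x : Ext X T.X₁ (n + 1 + 1))
      (Ext.eq_zero_of_injective _) rfl
    rw [← hy, (hQ X).elim y 0, Ext.zero_comp]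

section HomModule

variable (S : Type u) [Ring S] (M : Type u) [AddCommGroup M] [Module S M]

/-- `Hom_S(M, X)` seen as a right module over `End_S(M)`. -/
def HomM (X : Type u) [AddCommGroup X] [Module S X] : Type u := M →ₗ[S] X

variable (X : Type u) [AddCommGroup X] [Module S X]

instance : AddCommGroup (HomM S M X) := inferInstanceAs (AddCommGroup (M →ₗ[S] X))

instance : Module (Module.End S M)ᵐᵒᵖ (HomM S M X) where
  smul b f := LinearMap.comp (f : M →ₗ[S] X) b.unop
  one_smul _ := rfl
  mul_smul _ _ _ := rfl
  smul_zero b := LinearMap.zero_comp b.unop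
  smul_add b f g := LinearMap.add_comp b.unop g f
  add_smul b c f := LinearMap.comp_add b.unop c.unop (f : M →ₗ[S] X)
  zero_smul f := LinearMap.comp_zero (f : M →ₗ[S] X)

variable {X} {Y : Type u} [AddCommGroup Y] [Module S Y]

/-- Elements of `HomM` as linear maps. -/
def toL (f : HomM S M X) : M →ₗ[S] X := f

/-- Linear maps as elements of `HomM`. -/
def ofL (f : M →ₗ[S] X) : HomM S M X := f

lemma toL_sum {n : ℕ} (F : Fin n → HomM S M X) (m : M) :
    toL S M (∑ j, F j) m = ∑ j, toL S M (F j) m := by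
  let ev : HomM S M X →+ X :=
    { toFun := fun f => toL S M f m
      map_zero' := rfl
      map_add' := fun _ _ => rfl }
  exact map_sum ev F Finset.univ

/-- Functoriality of `HomM`. -/
def homMap (p : X →ₗ[S] Y) : HomM S M X →ₗ[(Module.End S M)ᵐᵒᵖ] HomM S M Y where
  toFun f := LinearMap.comp p (f : M →ₗ[S] X)
  map_add' f g := LinearMap.comp_add f g p
  map_smul' _ _ := rfl

/-- `Hom(M, M^a)` is free over `End(M)`. -/
def homPiEquiv (a : ℕ) : HomM S M (Fin a → M) ≃ₗ[(Module.End S M)ᵐᵒᵖ]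
    (Fin a → (Module.End S M)ᵐᵒᵖ) where
  toFun f j := MulOpposite.op (LinearMap.comp (LinearMap.proj j) (f : M →ₗ[S] (Fin a → M)))
  invFun g := LinearMap.pi fun j => (g j).unop
  map_add' _ _ := rfl
  map_smul' _ _ := rfl
  left_inv _ := rfl
  right_inv _ := rfl

instance (a : ℕ) : Module.Projective (Module.End S M)ᵐᵒᵖ (HomM S M (Fin a → M)) :=
  Module.Projective.of_equiv (homPiEquiv S M a).symm

/-- the short complex `Hom(M, ker p) → Hom(M, X) → Hom(M, Y)` -/
lemma hom_shortExact (p : X →ₗ[S] Y)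
    (hp : ∀ φ : M →ₗ[S] Y, ∃ ψ : M →ₗ[S] X, p ∘ₗ ψ = φ) :
    (ModuleCat.shortComplexOfCompEqZero (homMap S M (LinearMap.ker p).subtype) (homMap S M p)
      (by
        refine LinearMap.ext fun f => ?_
        exact LinearMap.ext fun m => (toL S M f m).2)).ShortExact := by
  apply ModuleCat.shortComplex_shortExact
  · intro f
    constructor
    · intro hf
      refine ⟨LinearMap.codRestrict (LinearMap.ker p) (f : M →ₗ[S] X) fun m => ?_, ?_⟩
      · exact LinearMap.congr_fun (f := (p ∘ₗ (f : M →ₗ[S] X) : M →ₗ[S] Y)) hf m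
      · exact LinearMap.ext fun m => rfl
    · rintro ⟨g, rfl⟩
      exact LinearMap.ext fun m => (toL S M g m).2
  · intro f g hfg
    refine LinearMap.ext fun m => Subtype.ext ?_
    exact LinearMap.congr_fun (f := ((LinearMap.ker p).subtype ∘ₗ (f : M →ₗ[S] LinearMap.ker p)))
      (g := ((LinearMap.ker p).subtype ∘ₗ (g : M →ₗ[S] LinearMap.ker p))) hfg m
  · intro φ
    obtain ⟨ψ, h⟩ := hp φ
    exact ⟨ψ, h⟩

/-- A finite approximation exists. -/
lemma exists_approx (R : Type u) [CommRing R] [IsArtinianRing R] [Algebra R S] [Module.Finite R S]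
    [Module.Finite S M] [Module.Finite S X] :
    ∃ (a : ℕ) (p : (Fin a → M) →ₗ[S] X),
      ∀ φ : M →ₗ[S] X, ∃ ψ : M →ₗ[S] (Fin a → M), p ∘ₗ ψ = φ := by
  let _ : Module R M := Module.compHom M (algebraMap R S)
  let _ : Module R X := Module.compHom X (algebraMap R S)
  have : IsScalarTower R S M := IsScalarTower.of_algebraMap_smul fun _ _ => rfl
  have : IsScalarTower R S X := IsScalarTower.of_algebraMap_smul fun _ _ => rfl
  have : SMulCommClass S R X := inferInstance
  have : SMulCommClass S R M := inferInstance
  have : Module.Finite R M := Module.Finite.trans S M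
  have : Module.Finite R X := Module.Finite.trans S X
  have : IsNoetherian R (M →ₗ[R] X) := inferInstance
  have hinj : Function.Injective (LinearMap.restrictScalarsₗ R S M X R) :=
    LinearMap.restrictScalars_injective R
  have : IsNoetherian R (M →ₗ[S] X) := isNoetherian_of_injective _ hinj
  obtain ⟨a, s, hs⟩ := Module.Finite.exists_fin (R := R) (M := M →ₗ[S] X)
  refine ⟨a, LinearMap.lsum S (fun _ => M) ℕ s, fun φ => ?_⟩
  have hφ : φ ∈ Submodule.span R (Set.range s) := hs ▸ Submodule.mem_top
  obtain ⟨c, rfl⟩ := (Submodule.mem_span_range_iff_exists_fun R).1 hφ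
  refine ⟨LinearMap.pi fun j => c j • LinearMap.id, LinearMap.ext fun m => ?_⟩
  simp [LinearMap.lsum_apply, LinearMap.sum_apply]

/-- `M` generates: any element of `X` is a sum of images of maps from `M`. -/
lemma gen_of_retract {n : ℕ} {f : S →ₗ[S] (Fin n → M)} {g : (Fin n → M) →ₗ[S] S}
    (hgf : g ∘ₗ f = LinearMap.id) (x : X) :
    ∃ h : Fin n → (M →ₗ[S] X), ∃ m : Fin n → M, ∑ j, h j (m j) = x := by
  refine ⟨fun j => LinearMap.toSpanSingleton S X x ∘ₗ g ∘ₗ LinearMap.single S (fun _ => M) j,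
    f 1, ?_⟩
  have h1 : g (f 1) = 1 := LinearMap.congr_fun hgf 1
  have h2 : ∑ j, LinearMap.single S (fun _ => M) j (f 1 j) = f 1 := by
    simpa using Finset.univ_sum_single (f 1)
  calc _ = LinearMap.toSpanSingleton S X x (g (∑ j, LinearMap.single S (fun _ => M) j (f 1 j))) := by
        simp only [map_sum, LinearMap.comp_apply]
    _ = x := by rw [h2, h1]; simp

/-- If `Hom(M, X)` is projective, then `X` is in `add M`. -/
lemma split_of_projective {n : ℕ} {f : S →ₗ[S] (Fin n → M)} {g : (Fin n → M) →ₗ[S] S}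
    (hgf : g ∘ₗ f = LinearMap.id) {a : ℕ} (p : (Fin a → M) →ₗ[S] X)
    (hp : ∀ φ : M →ₗ[S] X, ∃ ψ : M →ₗ[S] (Fin a → M), p ∘ₗ ψ = φ)
    (hps : Function.Surjective p)
    [Module.Projective (Module.End S M)ᵐᵒᵖ (HomM S M X)] :
    ∃ t : X →ₗ[S] (Fin a → M), p ∘ₗ t = LinearMap.id := by
  obtain ⟨s, hs⟩ := Module.projective_lifting_property (homMap S M p)
    (LinearMap.id : HomM S M X →ₗ[(Module.End S M)ᵐᵒᵖ] HomM S M X) hp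
  have hs' : ∀ φ : M →ₗ[S] X, p ∘ₗ (s φ : M →ₗ[S] (Fin a → M)) = φ := fun φ =>
    LinearMap.congr_fun hs φ
  let sg : Fin a → (M →ₗ[S] (Fin a → M)) := fun j => s (p ∘ₗ LinearMap.single S (fun _ => M) j)
  let σ : (Fin a → M) →ₗ[S] (Fin a → M) := LinearMap.lsum S (fun _ => M) ℕ sg
  have hσ : ∀ v, σ v = ∑ j, sg j (v j) := fun v => by
    simp [σ, LinearMap.lsum_apply, LinearMap.sum_apply]
  have hv : ∀ v : Fin a → M, ∑ j, LinearMap.single S (fun _ => M) j (v j) = v := fun v => by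
    simpa using Finset.univ_sum_single v
  have hpσ : ∀ v, p (σ v) = p v := fun v => by
    rw [hσ, map_sum]
    conv_rhs => rw [← hv v, map_sum]
    exact Finset.sum_congr rfl fun j _ => LinearMap.congr_fun (hs' _) (v j)
  have hσφ : ∀ φ : M →ₗ[S] (Fin a → M), σ ∘ₗ φ = (s (p ∘ₗ φ : M →ₗ[S] X) : M →ₗ[S] (Fin a → M)) := by
    intro φ
    have key : (p ∘ₗ φ : M →ₗ[S] X) = (∑ j, (MulOpposite.op (LinearMap.proj j ∘ₗ φ) :
        (Module.End S M)ᵐᵒᵖ) • ofL S M (p ∘ₗ LinearMap.single S (fun _ => M) j) : HomM S M X) := by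
      have : φ = ∑ j, LinearMap.single S (fun _ => M) j ∘ₗ (LinearMap.proj j ∘ₗ φ) := by
        ext1 m
        rw [LinearMap.sum_apply]
        exact (hv (φ m)).symm
      conv_lhs => rw [this]
      exact LinearMap.ext fun m => by
        rw [LinearMap.comp_apply, LinearMap.sum_apply, map_sum]
        exact (toL_sum S M (X := X) (fun j : Fin a => (MulOpposite.op (LinearMap.proj j ∘ₗ φ) :
          (Module.End S M)ᵐᵒᵖ) • ofL S M (p ∘ₗ LinearMap.single S (fun _ => M) j)) m).symm
    rw [key, map_sum]
    refine LinearMap.ext fun m => ?_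
    rw [LinearMap.comp_apply, hσ]
    simp only [map_smul]
    exact (toL_sum S M (X := Fin a → M) (fun j : Fin a => (MulOpposite.op (LinearMap.proj j ∘ₗ φ) :
          (Module.End S M)ᵐᵒᵖ) • s (ofL S M (p ∘ₗ LinearMap.single S (fun _ => M) j))) m).symm
  have hker : LinearMap.ker p ≤ LinearMap.ker σ := by
    intro v hvk
    obtain ⟨h, m, hm⟩ := gen_of_retract S M (X := LinearMap.ker p) hgf ⟨v, hvk⟩
    have h1 : v = ∑ j, (h j (m j) : Fin a → M) := by
      have := congrArg (LinearMap.ker p).subtype hm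
      rw [map_sum] at this
      exact this.symm
    rw [LinearMap.mem_ker, h1, map_sum]
    refine Finset.sum_eq_zero fun j _ => ?_
    have h2 := LinearMap.congr_fun (hσφ ((LinearMap.ker p).subtype ∘ₗ h j)) (m j)
    have h3 : p ∘ₗ ((LinearMap.ker p).subtype ∘ₗ h j) = 0 := LinearMap.ext fun x => (h j x).2
    rw [h3] at h2
    have h4 : s (0 : M →ₗ[S] X) = (0 : M →ₗ[S] (Fin a → M)) := map_zero s
    rw [h4] at h2
    exact h2
  let e := p.quotKerEquivOfSurjective hps
  refine ⟨(LinearMap.ker p).liftQ σ hker ∘ₗ e.symm.toLinearMap, LinearMap.ext fun x => ?_⟩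
  obtain ⟨v, rfl⟩ := hps x
  have he : e.symm (p v) = (LinearMap.ker p).mkQ v := by
    rw [LinearEquiv.symm_apply_eq]; rfl
  simp only [LinearMap.comp_apply, LinearEquiv.coe_coe, he, LinearMap.id_apply]
  exact hpσ v

end HomModule

lemma main (R : Type u) [CommRing R] [IsArtinianRing R]
    (S : Type u) [Ring S] [Algebra R S] [Module.Finite R S]
    [HasExt.{u} (ModuleCat.{u} S)]
    (T M : Type u) [AddCommGroup T] [Module S T]
    [AddCommGroup M] [Module S M] [Module.Finite S M]
    (hperp : ∀ (X : ModuleCat.{u} S), Module.Finite S X →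
      ((∀ i : ℕ, 1 ≤ i → Subsingleton (Abelian.Ext X (ModuleCat.of S T) i)) ↔
        (∃ (n : ℕ) (f : X →ₗ[S] (Fin n → M)) (g : (Fin n → M) →ₗ[S] X),
          g ∘ₗ f = LinearMap.id))) (n : ℕ) :
    ∀ (X : Type u) [AddCommGroup X] [Module S X] [Module.Finite S X],
      HasProjectiveDimensionLT (ModuleCat.of (Module.End S M)ᵐᵒᵖ (HomM S M X)) (n + 1) →
      ∀ i, n + 1 ≤ i → Subsingleton (Ext (ModuleCat.of S X) (ModuleCat.of S T) i) := by
  have hNoeth : IsNoetherianRing S := by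
    have : IsNoetherian R S := inferInstance
    exact isNoetherian_of_tower R this
  obtain ⟨k, f, g, hgf⟩ : ∃ (n : ℕ) (f : S →ₗ[S] (Fin n → M)) (g : (Fin n → M) →ₗ[S] S),
      g ∘ₗ f = LinearMap.id := by
    refine (hperp (ModuleCat.of S S) inferInstance).1 fun i hi => ?_
    have : Projective (ModuleCat.of S S) := (IsProjective.iff_projective S).1 inferInstance
    exact HasProjectiveDimensionLT.subsingleton _ 1 i hi _
  have happ : ∀ (X : Type u) [AddCommGroup X] [Module S X] [Module.Finite S X],
      ∃ (a : ℕ) (p : (Fin a → M) →ₗ[S] X),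
      (∀ φ : M →ₗ[S] X, ∃ ψ : M →ₗ[S] (Fin a → M), p ∘ₗ ψ = φ) ∧ Function.Surjective p := by
    intro X _ _ _
    obtain ⟨a, p, hp⟩ := exists_approx S M (X := X) R
    refine ⟨a, p, hp, fun x => ?_⟩
    obtain ⟨h, m, rfl⟩ := gen_of_retract S M hgf x
    choose ψ hψ using hp
    refine ⟨∑ j, ψ (h j) (m j), ?_⟩
    rw [map_sum]
    exact Finset.sum_congr rfl fun j _ => LinearMap.congr_fun (hψ _) (m j)
  induction n with
  | zero =>
    intro X _ _ _ hpd i hi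
    obtain ⟨a, p, hp, hps⟩ := happ X
    have hproj : Module.Projective (Module.End S M)ᵐᵒᵖ (HomM S M X) :=
      (IsProjective.iff_projective _).2 (projective_iff_hasProjectiveDimensionLT_one.2 hpd)
    obtain ⟨t, ht⟩ := split_of_projective S M hgf p hp hps
    exact (hperp (ModuleCat.of S X) ‹_›).2 ⟨a, t, p, ht⟩ i hi
  | succ n ih =>
    intro X _ _ _ hpd i hi
    obtain ⟨a, p, hp, hps⟩ := happ X
    have hse := hom_shortExact S M p hp
    have hpr : Projective (ModuleCat.of (Module.End S M)ᵐᵒᵖ (HomM S M (Fin a → M))) :=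
      (IsProjective.iff_projective _).1 inferInstance
    have hK := (hse.hasProjectiveDimensionLT_X₃_iff n hpr).1 hpd
    have hex := LinearMap.shortExact_shortComplexKer hps
    obtain ⟨j, rfl⟩ : ∃ j, i = 1 + j := ⟨i - 1, by omega⟩
    have hKT := ih (LinearMap.ker p) hK j (by omega)
    have hMT : Subsingleton (Ext (ModuleCat.of S (Fin a → M)) (ModuleCat.of S T) (1 + j)) :=
      (hperp (ModuleCat.of S (Fin a → M)) inferInstance).2
        ⟨a, LinearMap.id, LinearMap.id, rfl⟩ (1 + j) (by omega)
    refine subsingleton_of_forall_eq 0 fun x => ?_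
    obtain ⟨y, rfl⟩ := Ext.contravariant_sequence_exact₃ hex _ x (hMT.elim _ _) rfl
    rw [hKT.elim y 0, Ext.comp_zero]

end Stmt2Aux

/-- Let `A` be an Artin algebra (an algebra, finitely generated as a module,
over a commutative artinian ring `R`), and `T`, `M` finitely generated right `A`-modules
(modules over `Aᵐᵒᵖ`) such that `^⊥T = add M`, i.e. a finitely generated right `A`-module `X`
satisfies `Ext^i_A(X,T) = 0` for all `i ≥ 1` iff `X` is a direct summand of a finite direct
sum of copies of `M`.  Let `B = End_A(M)`.  Then for every `r ≥ 2`, if the (right) global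
dimension of `B` is at most `r` (all `Ext^{r+1}` over `B` vanish), then the injective
dimension of `T` is at most `r` (`Ext^{r+1}_A(-, T) = 0`). -/
theorem stmt_2
    (R : Type u) [CommRing R] [IsArtinianRing R]
    (A : Type u) [Ring A] [Algebra R A] [Module.Finite R A]
    [HasExt.{u} (ModuleCat.{u} Aᵐᵒᵖ)]
    (T M : Type u) [AddCommGroup T] [Module Aᵐᵒᵖ T] [Module.Finite Aᵐᵒᵖ T]
    [AddCommGroup M] [Module Aᵐᵒᵖ M] [Module.Finite Aᵐᵒᵖ M]
    [HasExt.{u} (ModuleCat.{u} ((Module.End Aᵐᵒᵖ M)ᵐᵒᵖ))]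
    -- `^⊥T = add M` :
    (hperp : ∀ (X : ModuleCat.{u} Aᵐᵒᵖ), Module.Finite Aᵐᵒᵖ X →
      ((∀ i : ℕ, 1 ≤ i → Subsingleton (Abelian.Ext X (ModuleCat.of Aᵐᵒᵖ T) i)) ↔
        (∃ (n : ℕ) (f : X →ₗ[Aᵐᵒᵖ] (Fin n → M)) (g : (Fin n → M) →ₗ[Aᵐᵒᵖ] X),
          g ∘ₗ f = LinearMap.id)))
    (r : ℕ) (hr : 2 ≤ r)
    -- `gl.dim B ≤ r` :
    (hgl : ∀ X Y : ModuleCat.{u} ((Module.End Aᵐᵒᵖ M)ᵐᵒᵖ),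
      Subsingleton (Abelian.Ext X Y (r + 1))) :
    -- `inj.dim T ≤ r` :
    ∀ X : ModuleCat.{u} Aᵐᵒᵖ, Subsingleton (Abelian.Ext X (ModuleCat.of Aᵐᵒᵖ T) (r + 1)) := by
  apply Stmt2Aux.ext_vanish_of_finite
  intro X hX
  have hfin : Module.Finite R Aᵐᵒᵖ := inferInstance
  exact Stmt2Aux.main R Aᵐᵒᵖ T M hperp r X
    (hasProjectiveDimensionLT_of_enoughInjectives _ _ (fun Y => hgl _ Y)) (r + 1) le_rfl
end

section
/- Let A be an Artin algebra, and let T, M be finitely generated right A-modules such that ^⊥T = add M. Let B = End_A(M). Then for every integer r ≥ 2, if the injective dimension of T is at most r, then the global dimension of B is at most r. -/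
set_option linter.unusedVariables false

open CategoryTheory
universe u

namespace StmtAux

/-- Baer criterion in terms of `Ext`. -/
theorem injDim_of_quot {S : Type u} [Ring S] [HasExt.{u} (ModuleCat.{u} S)] (n : ℕ) :
    ∀ Y : ModuleCat.{u} S,
    (∀ I : Ideal S, Subsingleton (Abelian.Ext (ModuleCat.of S (S ⧸ I)) Y (n + 1))) →
    HasInjectiveDimensionLT Y (n + 1) := by
  induction n with
  | zero =>
    intro Y h
    rw [zero_add, ← injective_iff_hasInjectiveDimensionLT_one,
      ← Module.injective_iff_injective_object S Y]
    apply Module.Baer.injective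
    intro I g
    let Sc : ShortComplex (ModuleCat.{u} S) :=
      ShortComplex.mk (ModuleCat.ofHom I.subtype) (ModuleCat.ofHom (Submodule.mkQ I)) (by
        ext x; simp)
    have hS : Sc.ShortExact := ModuleCat.shortComplex_shortExact _
      (LinearMap.exact_subtype_mkQ I) (Submodule.injective_subtype I)
      (Submodule.mkQ_surjective I)
    have h1 := h I
    obtain ⟨x, hx⟩ := Abelian.Ext.contravariant_sequence_exact₁ hS Y (n₀ := 0)
      (Abelian.Ext.mk₀ (ModuleCat.ofHom g : Sc.X₁ ⟶ Y)) (n₁ := 1) rfl (h1.elim _ _)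
    obtain ⟨x, rfl⟩ := Abelian.Ext.homEquiv₀.symm.surjective x
    rw [Abelian.Ext.homEquiv₀_symm_apply, Abelian.Ext.mk₀_comp_mk₀] at hx
    have hx := Abelian.Ext.homEquiv₀.symm.injective hx
    refine ⟨x.hom, fun s hs => ?_⟩
    have := congrArg (fun t => t.hom ⟨s, hs⟩) hx
    exact this
  | succ n ih =>
    intro Y h
    let Sc : ShortComplex (ModuleCat.{u} S) :=
      ShortComplex.mk (Injective.ι Y) (Limits.cokernel.π _) (Limits.cokernel.condition _)
    have hS : Sc.ShortExact := { exact := ShortComplex.exact_cokernel _ }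
    have hinj : Injective Sc.X₂ := inferInstanceAs (Injective (Injective.under Y))
    refine (hS.hasInjectiveDimensionLT_X₃_iff n hinj).1 (ih _ fun I => ?_)
    refine subsingleton_of_forall_eq 0 fun x => ?_
    have h1 := h I
    obtain ⟨y, rfl⟩ := Abelian.Ext.covariant_sequence_exact₃ _ hS x (n₁ := n + 2) rfl
      (h1.elim _ _)
    rw [Abelian.Ext.eq_zero_of_injective y, Abelian.Ext.zero_comp]

section
variable (Λ : Type u) [Ring Λ] (M X Y : Type u) [AddCommGroup M] [Module Λ M]
  [AddCommGroup X] [Module Λ X] [AddCommGroup Y] [Module Λ Y]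

/-- `Hom(M, X)` as a right module over `End M`. -/
def HH : Type u := M →ₗ[Λ] X

instance : AddCommGroup (HH Λ M X) := inferInstanceAs (AddCommGroup (M →ₗ[Λ] X))

instance : Module (Module.End Λ M)ᵐᵒᵖ (HH Λ M X) where
  smul b f := (show M →ₗ[Λ] X from f) ∘ₗ (b.unop : M →ₗ[Λ] M)
  one_smul _ := rfl
  mul_smul _ _ _ := rfl
  smul_zero b := LinearMap.zero_comp (σ₁₂ := RingHom.id Λ) (σ₂₃ := RingHom.id Λ) _
  smul_add _ _ _ := rfl
  add_smul a b f := LinearMap.comp_add (σ₁₂ := RingHom.id Λ) (σ₂₃ := RingHom.id Λ) _ _ _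
  zero_smul f := LinearMap.comp_zero (σ₁₂ := RingHom.id Λ) (σ₂₃ := RingHom.id Λ) _

variable {Λ X Y}

/-- functoriality of `Hom(M, -)`. -/
def HH.map (φ : X →ₗ[Λ] Y) : HH Λ M X →ₗ[(Module.End Λ M)ᵐᵒᵖ] HH Λ M Y where
  toFun f := φ ∘ₗ (show M →ₗ[Λ] X from f)
  map_add' f g := LinearMap.comp_add (σ₁₂ := RingHom.id Λ) (σ₂₃ := RingHom.id Λ) _ _ _
  map_smul' _ _ := rfl

variable (Λ) in
/-- `Hom(M, M^k)` is free. -/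
def HH.piEquiv (k : ℕ) :
    HH Λ M (Fin k → M) ≃ₗ[(Module.End Λ M)ᵐᵒᵖ] (Fin k → (Module.End Λ M)ᵐᵒᵖ) where
  toFun f i := MulOpposite.op (LinearMap.proj i ∘ₗ (show M →ₗ[Λ] (Fin k → M) from f))
  invFun g := LinearMap.pi fun i => ((g i).unop : M →ₗ[Λ] M)
  left_inv f := rfl
  right_inv g := rfl
  map_add' f g := rfl
  map_smul' _ _ := rfl

theorem HH.projective_pi (k : ℕ) :
    Module.Projective (Module.End Λ M)ᵐᵒᵖ (HH Λ M (Fin k → M)) :=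
  Module.Projective.of_equiv (HH.piEquiv Λ M k).symm

theorem HH.projective_of_retract (k : ℕ) (f : X →ₗ[Λ] (Fin k → M)) (g : (Fin k → M) →ₗ[Λ] X)
    (h : g ∘ₗ f = LinearMap.id) : Module.Projective (Module.End Λ M)ᵐᵒᵖ (HH Λ M X) := by
  have := HH.projective_pi (Λ := Λ) M k
  refine Module.Projective.of_split (HH.map M f) (HH.map M g) ?_
  ext a
  change g ∘ₗ (f ∘ₗ (show M →ₗ[Λ] X from a)) = (show M →ₗ[Λ] X from a)
  rw [← LinearMap.comp_assoc, h, LinearMap.id_comp]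

theorem HH.exact (φ : X →ₗ[Λ] Y) :
    Function.Exact (HH.map M (LinearMap.ker φ).subtype) (HH.map M φ) := by
  intro f
  constructor
  · intro hf
    refine ⟨LinearMap.codRestrict (LinearMap.ker φ) (show M →ₗ[Λ] X from f) fun m => ?_, rfl⟩
    exact LinearMap.congr_fun (f := φ ∘ₗ (show M →ₗ[Λ] X from f)) (g := 0) hf m
  · rintro ⟨g, rfl⟩
    refine LinearMap.ext (f := φ ∘ₗ (LinearMap.ker φ).subtype ∘ₗ (show M →ₗ[Λ] _ from g))
      (g := 0) fun m => ?_
    exact ((show M →ₗ[Λ] LinearMap.ker φ from g) m).2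

theorem HH.inj (φ : X →ₗ[Λ] Y) :
    Function.Injective (HH.map M (LinearMap.ker φ).subtype) := by
  intro f g h
  refine LinearMap.ext (f := (show M →ₗ[Λ] _ from f)) (g := (show M →ₗ[Λ] _ from g)) fun m => ?_
  exact Subtype.ext (LinearMap.congr_fun (f := _ ∘ₗ (show M →ₗ[Λ] _ from f))
    (g := _ ∘ₗ (show M →ₗ[Λ] _ from g)) h m)

/-- A tuple of maps `M → X` assembled to a map `M^k → X`. -/
def sumMap {k : ℕ} (s : Fin k → HH Λ M X) : (Fin k → M) →ₗ[Λ] X :=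
  ∑ i, (show M →ₗ[Λ] X from s i) ∘ₗ LinearMap.proj i

theorem map_sumMap {k : ℕ} (s : Fin k → HH Λ M X) (f : HH Λ M (Fin k → M)) :
    HH.map M (sumMap M s) f = ∑ i, (HH.piEquiv Λ M k f i) • s i := by
  change (∑ i, (show M →ₗ[Λ] X from s i) ∘ₗ LinearMap.proj i) ∘ₗ
    (show M →ₗ[Λ] (Fin k → M) from f) = _
  let c : ((Fin k → M) →ₗ[Λ] X) →+ HH Λ M X :=
    AddMonoidHom.mk' (fun g => g ∘ₗ (show M →ₗ[Λ] (Fin k → M) from f)) fun _ _ => rfl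
  exact map_sum c _ _

theorem range_sumMap {k : ℕ} (s : Fin k → HH Λ M X) :
    LinearMap.range (HH.map M (sumMap M s)) =
      Submodule.span (Module.End Λ M)ᵐᵒᵖ (Set.range s) := by
  ext x
  rw [Submodule.mem_span_range_iff_exists_fun]
  constructor
  · rintro ⟨f, rfl⟩
    exact ⟨_, (map_sumMap M s f).symm⟩
  · rintro ⟨c, rfl⟩
    refine ⟨(HH.piEquiv Λ M k).symm c, ?_⟩
    rw [map_sumMap, LinearEquiv.apply_symm_apply]
end

theorem isNoetherian_hom (R : Type u) [CommRing R] [IsNoetherianRing R] (Λ : Type u) [Ring Λ] [Algebra R Λ]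
    [Module.Finite R Λ] (M X : Type u) [AddCommGroup M] [Module Λ M] [Module.Finite Λ M]
    [AddCommGroup X] [Module Λ X] [Module.Finite Λ X]
    [Module R M] [IsScalarTower R Λ M] [Module R X] [IsScalarTower R Λ X]
    [SMulCommClass Λ R X] :
    IsNoetherian R (M →ₗ[Λ] X) := by
  have : Module.Finite R M := Module.Finite.trans Λ M
  have : Module.Finite R X := Module.Finite.trans Λ X
  exact isNoetherian_of_injective (LinearMap.restrictScalarsₗ R Λ M X R)
    (LinearMap.restrictScalars_injective R)

theorem finite_HH (R : Type u) [CommRing R] [IsNoetherianRing R] (Λ : Type u) [Ring Λ] [Algebra R Λ]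
    [Module.Finite R Λ] (M X : Type u) [AddCommGroup M] [Module Λ M] [Module.Finite Λ M]
    [AddCommGroup X] [Module Λ X] [Module.Finite Λ X] : Module.Finite (Module.End Λ M)ᵐᵒᵖ (HH Λ M X) := by
  let := Module.compHom M (algebraMap R Λ)
  let := Module.compHom X (algebraMap R Λ)
  have : IsScalarTower R Λ M := ⟨fun r a m => by
    rw [Algebra.smul_def, mul_smul]; rfl⟩
  have : IsScalarTower R Λ X := ⟨fun r a m => by
    rw [Algebra.smul_def, mul_smul]; rfl⟩
  have : SMulCommClass Λ R M := IsScalarTower.to_smulCommClass'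
  have : SMulCommClass Λ R X := IsScalarTower.to_smulCommClass'
  have := isNoetherian_hom R Λ M X
  obtain ⟨s, hs⟩ := (Module.Finite.fg_top : (⊤ : Submodule R (M →ₗ[Λ] X)).FG)
  refine ⟨⟨s, ?_⟩⟩
  rw [eq_top_iff]
  intro f _
  have hf : (show M →ₗ[Λ] X from f) ∈ Submodule.span R (s : Set (M →ₗ[Λ] X)) := by
    rw [hs]; trivial
  refine Submodule.span_induction (p := fun (g : M →ₗ[Λ] X) _ =>
    (show HH Λ M X from g) ∈ Submodule.span (Module.End Λ M)ᵐᵒᵖ (show Set (HH Λ M X) from (s : Set (M →ₗ[Λ] X))))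
    ?_ ?_ ?_ ?_ hf
  · intro x hx; exact Submodule.subset_span hx
  · exact Submodule.zero_mem _
  · intro x y _ _ hx hy; exact Submodule.add_mem _ hx hy
  · intro r x _ hx
    have : (show HH Λ M X from r • x) =
      (MulOpposite.op (algebraMap R (Module.End Λ M) r)) • (show HH Λ M X from x) := by
      refine LinearMap.ext (f := r • x) (g := x ∘ₗ (algebraMap R (Module.End Λ M) r)) fun m => ?_
      change r • x m = x ((algebraMap R Λ r) • m)
      rw [map_smul]; rfl
    rw [this]
    exact Submodule.smul_mem _ _ hx

theorem noeth_End (R : Type u) [CommRing R] [IsNoetherianRing R] (Λ : Type u) [Ring Λ] [Algebra R Λ]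
    [Module.Finite R Λ] (M : Type u) [AddCommGroup M] [Module Λ M] [Module.Finite Λ M] : IsNoetherianRing (Module.End Λ M)ᵐᵒᵖ := by
  let := Module.compHom M (algebraMap R Λ)
  have : IsScalarTower R Λ M := ⟨fun r a m => by
    rw [Algebra.smul_def, mul_smul]; rfl⟩
  have : SMulCommClass Λ R M := IsScalarTower.to_smulCommClass'
  have : IsNoetherian R (Module.End Λ M) := isNoetherian_hom R Λ M M
  exact IsNoetherianRing.of_finite R _

theorem ext_shift {S : Type u} [Ring S] [HasExt.{u} (ModuleCat.{u} S)]
    {Sc : ShortComplex (ModuleCat.{u} S)} (hS : Sc.ShortExact) (T : ModuleCat.{u} S) (i : ℕ)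
    (h2 : Subsingleton (Abelian.Ext Sc.X₂ T i)) (h3 : Subsingleton (Abelian.Ext Sc.X₃ T (i + 1))) :
    Subsingleton (Abelian.Ext Sc.X₁ T i) := by
  refine subsingleton_of_forall_eq 0 fun x => ?_
  obtain ⟨y, rfl⟩ := Abelian.Ext.contravariant_sequence_exact₁ hS T x (n₁ := i + 1) (add_comm 1 i)
    (h3.elim _ _)
  rw [h2.elim y 0, Abelian.Ext.comp_zero]

theorem pd_main (Λ : Type u) [Ring Λ] [IsNoetherianRing Λ] [HasExt.{u} (ModuleCat.{u} Λ)]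
    (T M : Type u) [AddCommGroup T] [Module Λ T]
    [AddCommGroup M] [Module Λ M] [Module.Finite Λ M]
    (hfin : ∀ (X : Type u) [AddCommGroup X] [Module Λ X] [Module.Finite Λ X],
      Module.Finite (Module.End Λ M)ᵐᵒᵖ (HH Λ M X))
    (hperp : ∀ (X : ModuleCat.{u} Λ), Module.Finite Λ X →
      ((∀ i : ℕ, 1 ≤ i → Subsingleton (Abelian.Ext X (ModuleCat.of Λ T) i)) ↔
        (∃ (n : ℕ) (f : X →ₗ[Λ] (Fin n → M)) (g : (Fin n → M) →ₗ[Λ] X),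
          g ∘ₗ f = LinearMap.id))) (n : ℕ) :
    ∀ (X : Type u) [AddCommGroup X] [Module Λ X] [Module.Finite Λ X],
      (∀ i, n + 1 ≤ i → Subsingleton (Abelian.Ext (ModuleCat.of Λ X) (ModuleCat.of Λ T) i)) →
      HasProjectiveDimensionLT (ModuleCat.of (Module.End Λ M)ᵐᵒᵖ (HH Λ M X)) (n + 1) := by
  induction n with
  | zero =>
    intro X _ _ hX h
    obtain ⟨k, f, g, hfg⟩ := (hperp (ModuleCat.of Λ X) hX).1 h
    rw [zero_add, ← projective_iff_hasProjectiveDimensionLT_one, ← IsProjective.iff_projective]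
    exact HH.projective_of_retract M k f g hfg
  | succ n ih =>
    intro X _ _ hX h
    have hF := hfin X
    obtain ⟨k, s, hs⟩ := Submodule.fg_iff_exists_fin_generating_family.1 hF.fg_top
    have hsurjH : Function.Surjective (HH.map M (sumMap M s)) := by
      rw [← LinearMap.range_eq_top, range_sumMap, hs]
    have hΛ : ∃ (n : ℕ) (f : Λ →ₗ[Λ] (Fin n → M)) (g : (Fin n → M) →ₗ[Λ] Λ),
        g ∘ₗ f = LinearMap.id := by
      refine (hperp (ModuleCat.of Λ Λ) inferInstance).1 fun i hi => ?_
      have : Projective (ModuleCat.of Λ Λ) :=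
        (IsProjective.iff_projective (R := Λ) Λ).1 inferInstance
      exact HasProjectiveDimensionLT.subsingleton _ 1 i hi _
    have hsurj : Function.Surjective (sumMap M s) := by
      obtain ⟨m, f, g, hfg⟩ := hΛ
      rw [← LinearMap.range_eq_top, eq_top_iff]
      intro x _
      let q : (Fin m → M) →ₗ[Λ] X := LinearMap.toSpanSingleton Λ X x ∘ₗ g
      have hx : x = q (f 1) := by
        have := LinearMap.congr_fun hfg 1
        change g (f 1) = 1 at this
        simp [q, this]
      have hq : ∀ v, q v ∈ LinearMap.range (sumMap M s) := by
        intro v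
        rw [← Finset.univ_sum_single v, map_sum]
        refine Submodule.sum_mem _ fun i _ => ?_
        obtain ⟨f', hf'⟩ := hsurjH (q ∘ₗ LinearMap.single Λ (fun _ => M) i)
        have h' := LinearMap.congr_fun (f := sumMap M s ∘ₗ (show M →ₗ[Λ] (Fin k → M) from f'))
          (g := q ∘ₗ LinearMap.single Λ (fun _ => M) i) hf' (v i)
        exact ⟨_, h'⟩
      rw [hx]
      exact hq _
    have hMk := (hperp (ModuleCat.of Λ (Fin k → M)) inferInstance).2
      ⟨k, LinearMap.id, LinearMap.id, rfl⟩
    have hS := LinearMap.shortExact_shortComplexKer hsurj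
    have hK := ih (LinearMap.ker (sumMap M s)) fun i hi =>
      ext_shift hS (ModuleCat.of Λ T) i (hMk i (by omega)) (h (i + 1) (by omega))
    let Sc : ShortComplex (ModuleCat.{u} (Module.End Λ M)ᵐᵒᵖ) :=
      ShortComplex.mk (ModuleCat.ofHom (HH.map M (LinearMap.ker (sumMap M s)).subtype))
        (ModuleCat.ofHom (HH.map M (sumMap M s)))
        (by ext x; exact (HH.exact M (sumMap M s) _).2 ⟨x, rfl⟩)
    have hSc : Sc.ShortExact := ModuleCat.shortComplex_shortExact _
      (HH.exact M _) (HH.inj M _) hsurjH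
    have hP : Projective Sc.X₂ :=
      (IsProjective.iff_projective (HH Λ M (Fin k → M))).1 (HH.projective_pi M k)
    exact (hSc.hasProjectiveDimensionLT_X₃_iff n hP).2 hK

theorem main (Λ : Type u) [Ring Λ] [IsNoetherianRing Λ] [HasExt.{u} (ModuleCat.{u} Λ)]
    (T M : Type u) [AddCommGroup T] [Module Λ T]
    [AddCommGroup M] [Module Λ M] [Module.Finite Λ M]
    [HasExt.{u} (ModuleCat.{u} ((Module.End Λ M)ᵐᵒᵖ))]
    (hnoeth : IsNoetherianRing (Module.End Λ M)ᵐᵒᵖ)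
    (hfin : ∀ (X : Type u) [AddCommGroup X] [Module Λ X] [Module.Finite Λ X],
      Module.Finite (Module.End Λ M)ᵐᵒᵖ (HH Λ M X))
    (hperp : ∀ (X : ModuleCat.{u} Λ), Module.Finite Λ X →
      ((∀ i : ℕ, 1 ≤ i → Subsingleton (Abelian.Ext X (ModuleCat.of Λ T) i)) ↔
        (∃ (n : ℕ) (f : X →ₗ[Λ] (Fin n → M)) (g : (Fin n → M) →ₗ[Λ] X),
          g ∘ₗ f = LinearMap.id))) (r : ℕ) (hr : 2 ≤ r)
    (hinj : ∀ X : ModuleCat.{u} Λ,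
      Subsingleton (Abelian.Ext X (ModuleCat.of Λ T) (r + 1))) :
    ∀ X Y : ModuleCat.{u} ((Module.End Λ M)ᵐᵒᵖ),
      Subsingleton (Abelian.Ext X Y (r + 1)) := by
  intro X Y
  have hT := hasInjectiveDimensionLT_of_enoughProjectives (ModuleCat.of Λ T) (r + 1) hinj
  suffices HasInjectiveDimensionLT Y (r + 1) from
    HasInjectiveDimensionLT.subsingleton Y (r + 1) (r + 1) le_rfl X
  refine injDim_of_quot r Y fun I => ?_
  suffices HasProjectiveDimensionLT (ModuleCat.of (Module.End Λ M)ᵐᵒᵖ ((Module.End Λ M)ᵐᵒᵖ ⧸ I)) (r + 1) from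
    HasProjectiveDimensionLT.subsingleton _ (r + 1) (r + 1) le_rfl Y
  obtain ⟨r, rfl⟩ := Nat.exists_eq_add_of_le' hr
  obtain ⟨k, s, hs⟩ := Submodule.fg_iff_exists_fin_generating_family.1 (hnoeth.noetherian I)
  let e : HH Λ M M ≃ₗ[(Module.End Λ M)ᵐᵒᵖ] (Module.End Λ M)ᵐᵒᵖ :=
    { toFun := fun f => MulOpposite.op f
      invFun := fun g => g.unop
      left_inv := fun _ => rfl
      right_inv := fun _ => rfl
      map_add' := fun _ _ => rfl
      map_smul' := fun _ _ => rfl }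
  let t : Fin k → HH Λ M M := fun i => e.symm (s i)
  let φ := sumMap M t
  have hrange : LinearMap.range (e.toLinearMap ∘ₗ HH.map M φ) = I := by
    rw [LinearMap.range_comp, range_sumMap, Submodule.map_span, ← Set.range_comp, ← hs]
    congr 1
  -- vanishing for the kernel
  have hMk := (hperp (ModuleCat.of Λ (Fin k → M)) inferInstance).2
    ⟨k, LinearMap.id, LinearMap.id, rfl⟩
  have hM := (hperp (ModuleCat.of Λ M) inferInstance).2
    ⟨1, LinearMap.pi fun _ => LinearMap.id, LinearMap.proj 0, rfl⟩
  have hS1 := LinearMap.shortExact_shortComplexKer φ.surjective_rangeRestrict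
  have hS2 : (ShortComplex.mk (ModuleCat.ofHom (LinearMap.range φ).subtype)
      (ModuleCat.ofHom (Submodule.mkQ (LinearMap.range φ))) (by
        ext x; simp)).ShortExact := ModuleCat.shortComplex_shortExact _
      (LinearMap.exact_subtype_mkQ _) (Submodule.injective_subtype _)
      (Submodule.mkQ_surjective _)
  have hK0 : ∀ i, r + 1 ≤ i → Subsingleton (Abelian.Ext
      (ModuleCat.of Λ (LinearMap.ker φ.rangeRestrict)) (ModuleCat.of Λ T) i) := fun i hi =>
    ext_shift hS1 (ModuleCat.of Λ T) i (hMk i (by omega))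
      (ext_shift hS2 (ModuleCat.of Λ T) (i + 1) (hM (i + 1) (by omega))
        (HasInjectiveDimensionLT.subsingleton _ (r + 2 + 1) (i + 1 + 1) (by omega) _))
  rw [LinearMap.ker_rangeRestrict] at hK0
  have hK := pd_main Λ T M hfin hperp r (LinearMap.ker φ) hK0
  let ψ : HH Λ M (Fin k → M) →ₗ[(Module.End Λ M)ᵐᵒᵖ] I :=
    LinearMap.codRestrict I (e.toLinearMap ∘ₗ HH.map M φ) fun x => by
      conv => enter [1]; rw [← hrange]
      exact ⟨x, rfl⟩
  have hψs : Function.Surjective ψ := by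
    rintro ⟨x, hx⟩
    have hx' := hx
    conv at hx' => enter [1]; rw [← hrange]
    obtain ⟨y, hy⟩ := hx'
    exact ⟨y, Subtype.ext hy⟩
  have hψe : Function.Exact (HH.map M (LinearMap.ker φ).subtype) ψ := by
    intro x
    rw [← HH.exact M φ x, ← Subtype.coe_inj]
    exact e.map_eq_zero_iff
  let S3 : ShortComplex (ModuleCat.{u} (Module.End Λ M)ᵐᵒᵖ) :=
    ShortComplex.mk (ModuleCat.ofHom (HH.map M (LinearMap.ker φ).subtype)) (ModuleCat.ofHom ψ)
      (by ext x; exact congrArg _ ((hψe _).2 ⟨x, rfl⟩))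
  have hS3 : S3.ShortExact := ModuleCat.shortComplex_shortExact _ hψe (HH.inj M _) hψs
  have hP3 : Projective S3.X₂ :=
    (IsProjective.iff_projective (HH Λ M (Fin k → M))).1 (HH.projective_pi M k)
  have hI := (hS3.hasProjectiveDimensionLT_X₃_iff r hP3).2 hK
  let S4 : ShortComplex (ModuleCat.{u} (Module.End Λ M)ᵐᵒᵖ) :=
    ShortComplex.mk (ModuleCat.ofHom I.subtype) (ModuleCat.ofHom (Submodule.mkQ I)) (by
        ext x; simp)
  have hS4 : S4.ShortExact := ModuleCat.shortComplex_shortExact _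
      (LinearMap.exact_subtype_mkQ I) (Submodule.injective_subtype I)
      (Submodule.mkQ_surjective I)
  have hP4 : Projective S4.X₂ :=
    (IsProjective.iff_projective (R := (Module.End Λ M)ᵐᵒᵖ) (Module.End Λ M)ᵐᵒᵖ).1 inferInstance
  exact (hS4.hasProjectiveDimensionLT_X₃_iff (r + 1) hP4).2 hI

end StmtAux

/-- Let `A` be an Artin algebra (an algebra, finitely generated as a module,
over a commutative artinian ring `R`), and `T`, `M` finitely generated right `A`-modules
(modules over `Aᵐᵒᵖ`) such that `^⊥T = add M`, i.e. a finitely generated right `A`-module `X`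
satisfies `Ext^i_A(X,T) = 0` for all `i ≥ 1` iff `X` is a direct summand of a finite direct
sum of copies of `M`.  Let `B = End_A(M)`.  Then for every `r ≥ 2`, if the injective dimension of `T`
is at most `r` (`Ext^{r+1}_A(-, T) = 0`), then the (right) global dimension of `B` is at
most `r` (all `Ext^{r+1}` over `B` vanish). -/
theorem stmt_3
    (R : Type u) [CommRing R] [IsArtinianRing R]
    (A : Type u) [Ring A] [Algebra R A] [Module.Finite R A]
    [HasExt.{u} (ModuleCat.{u} Aᵐᵒᵖ)]
    (T M : Type u) [AddCommGroup T] [Module Aᵐᵒᵖ T] [Module.Finite Aᵐᵒᵖ T]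
    [AddCommGroup M] [Module Aᵐᵒᵖ M] [Module.Finite Aᵐᵒᵖ M]
    [HasExt.{u} (ModuleCat.{u} ((Module.End Aᵐᵒᵖ M)ᵐᵒᵖ))]
    -- `^⊥T = add M` :
    (hperp : ∀ (X : ModuleCat.{u} Aᵐᵒᵖ), Module.Finite Aᵐᵒᵖ X →
      ((∀ i : ℕ, 1 ≤ i → Subsingleton (Abelian.Ext X (ModuleCat.of Aᵐᵒᵖ T) i)) ↔
        (∃ (n : ℕ) (f : X →ₗ[Aᵐᵒᵖ] (Fin n → M)) (g : (Fin n → M) →ₗ[Aᵐᵒᵖ] X),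
          g ∘ₗ f = LinearMap.id)))
    (r : ℕ) (hr : 2 ≤ r)
    -- `inj.dim T ≤ r` :
    (hinj : ∀ X : ModuleCat.{u} Aᵐᵒᵖ,
      Subsingleton (Abelian.Ext X (ModuleCat.of Aᵐᵒᵖ T) (r + 1))) :
    -- `gl.dim B ≤ r` :
    ∀ X Y : ModuleCat.{u} ((Module.End Aᵐᵒᵖ M)ᵐᵒᵖ),
      Subsingleton (Abelian.Ext X Y (r + 1)) := by
  have : IsNoetherianRing Aᵐᵒᵖ := IsNoetherianRing.of_finite R _
  exact StmtAux.main Aᵐᵒᵖ T M (StmtAux.noeth_End R Aᵐᵒᵖ M)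
    (fun X _ _ _ => StmtAux.finite_HH R Aᵐᵒᵖ M X) hperp r hr hinj
end

section
/- Let A be an Artin algebra, T, M ∈ mod A with ^⊥T = add M, and suppose inj.dim T ≤ r for some r ≥ 2. Then for every X ∈ mod A there is an exact sequence 0 → M_r → M_{r-1} → ⋯ → M_0 → X → 0 with each M_i ∈ add M. -/
open CategoryTheory CategoryTheory.Limits

universe u

namespace Stmt4Aux

open Abelian ZeroObject

variable {C : Type*} [Category C] [Abelian C]

/-- Prepending an arrow to an exact sequence. -/
lemma exact_precomp {n : ℕ} (S : ComposableArrows C (n + 1)) (hS : S.Exact) {X : C}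
    (f : X ⟶ S.left) (w : f ≫ S.map' 0 1 = 0)
    (h : (ShortComplex.mk f (S.map' 0 1) w).Exact) : (S.precomp f).Exact :=
  ComposableArrows.exact_of_δ₀ h.exact_toComposableArrows hS

lemma shift_down [HasExt.{u} C] {S : ShortComplex C} (hS : S.ShortExact) [Projective S.X₂] (T : C)
    (m : ℕ) (hm : 1 ≤ m) (h : Subsingleton (Ext.{u} S.X₃ T (m + 1))) :
    Subsingleton (Ext.{u} S.X₁ T m) := by
  obtain ⟨m, rfl⟩ := Nat.exists_eq_add_of_le' hm
  refine subsingleton_of_forall_eq 0 fun x => ?_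
  obtain ⟨y, hy⟩ := Ext.contravariant_sequence_exact₁ hS T x (add_comm 1 (m + 1))
    (Subsingleton.elim _ _)
  rw [← hy, Ext.eq_zero_of_projective y, Ext.comp_zero]

lemma shift_up [HasExt.{u} C] {S : ShortComplex C} (hS : S.ShortExact) [Projective S.X₂] (T : C)
    (m : ℕ) (h : Subsingleton (Ext.{u} S.X₁ T m)) :
    Subsingleton (Ext.{u} S.X₃ T (m + 1)) := by
  refine subsingleton_of_forall_eq 0 fun x => ?_
  obtain ⟨y, hy⟩ := Ext.contravariant_sequence_exact₃ hS T x
    (Ext.eq_zero_of_projective _) (add_comm 1 m)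
  rw [← hy, Subsingleton.elim y 0, Ext.comp_zero]

lemma shortExact_kernel {P K : C} (p : P ⟶ K) [Epi p] :
    (ShortComplex.mk (kernel.ι p) p (kernel.condition p)).ShortExact where
  exact := ShortComplex.exact_kernel p

lemma ext_vanish [EnoughProjectives C] [HasExt.{u} C] (T : C) (r : ℕ)
    (h : ∀ X : C, Subsingleton (Ext.{u} X T (r + 1))) (k : ℕ) :
    ∀ X : C, Subsingleton (Ext.{u} X T (r + 1 + k)) := by
  induction k with
  | zero => exact h
  | succ k ih =>
    intro X
    exact shift_up (shortExact_kernel (Projective.π X)) T _ (ih _)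

lemma exact_epi_comp {P K Y Z : C} (p : P ⟶ K) [Epi p] (i : K ⟶ Y) (g : Y ⟶ Z)
    (w : i ≫ g = 0) (w1 : (p ≫ i) ≫ g = 0) (hex : (ShortComplex.mk i g w).Exact) :
    (ShortComplex.mk (p ≫ i) g w1).Exact := by
  let φ : ShortComplex.mk (p ≫ i) g w1 ⟶ ShortComplex.mk i g w :=
    { τ₁ := p, τ₂ := 𝟙 _, τ₃ := 𝟙 _ }
  have : Epi φ.τ₁ := inferInstanceAs (Epi p)
  have : IsIso φ.τ₂ := inferInstanceAs (IsIso (𝟙 _))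
  have : Mono φ.τ₃ := inferInstanceAs (Mono (𝟙 _))
  exact (ShortComplex.exact_iff_of_epi_of_isIso_of_mono φ).2 hex

lemma exact_kernel_comp {P K Y : C} (p : P ⟶ K) (i : K ⟶ Y) [Mono i]
    (w : kernel.ι p ≫ (p ≫ i) = 0) : (ShortComplex.mk (kernel.ι p) (p ≫ i) w).Exact := by
  let φ : ShortComplex.mk (kernel.ι p) p (kernel.condition p) ⟶
      ShortComplex.mk (kernel.ι p) (p ≫ i) w :=
    { τ₁ := 𝟙 _, τ₂ := 𝟙 _, τ₃ := i }
  have : Epi φ.τ₁ := inferInstanceAs (Epi (𝟙 _))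
  have : IsIso φ.τ₂ := inferInstanceAs (IsIso (𝟙 _))
  have : Mono φ.τ₃ := inferInstanceAs (Mono i)
  exact (ShortComplex.exact_iff_of_epi_of_isIso_of_mono φ).1 (ShortComplex.exact_kernel p)

/-- Finite resolutions built one projective at a time. -/
lemma resolution [HasExt.{u} C] (T : C) (FinP Add : C → Prop)
    (hcover : ∀ K : C, FinP K → ∃ (P : C) (p : P ⟶ K), Epi p ∧ Projective P ∧ Add P ∧
      FinP (kernel p))
    (r : ℕ) (X : C) (hX : FinP X)
    (hv : ∀ m, r + 1 ≤ m → Subsingleton (Ext.{u} X T m)) (k : ℕ) :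
    ∃ (S : ComposableArrows C (k + 1)) (K : C) (i : K ⟶ S.left) (w : i ≫ S.map' 0 1 = 0),
      S.Exact ∧ Mono i ∧ (ShortComplex.mk i (S.map' 0 1) w).Exact ∧ FinP K ∧
      (∀ m, 1 ≤ m → r + 1 ≤ m + k → Subsingleton (Ext.{u} K T m)) ∧
      IsZero (S.obj ⟨k + 1, by omega⟩) ∧ Nonempty (S.obj ⟨k, by omega⟩ ≅ X) ∧
      (∀ (j : ℕ) (_ : j < k), Add (S.obj ⟨j, by omega⟩)) := by
  induction k with
  | zero =>
    refine ⟨ComposableArrows.mk₁ (0 : X ⟶ 0), X, 𝟙 X, comp_zero, ComposableArrows.exact₁ _,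
      (inferInstance : Mono (𝟙 X)), ?_, hX, fun m _ h => hv m h, isZero_zero C, ⟨Iso.refl X⟩,
      fun j hj => absurd hj (by omega)⟩
    exact (ShortComplex.exact_iff_epi (ShortComplex.mk (𝟙 X) (0 : X ⟶ 0) comp_zero) rfl).2
      (inferInstanceAs (Epi (𝟙 X)))
  | succ k ih =>
    obtain ⟨S, K, i, w, hS, hi, hex, hK, hvK, hz, hiso, hadd⟩ := ih
    obtain ⟨P, p, hp, hproj, hP, hfin⟩ := hcover K hK
    have w1 : (p ≫ i) ≫ S.map' 0 1 = 0 := by rw [Category.assoc, w, comp_zero]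
    have w2 : kernel.ι p ≫ (p ≫ i) = 0 := by rw [kernel.condition_assoc, zero_comp]
    have hex1 := exact_epi_comp p i (S.map' 0 1) w w1 hex
    have hker := exact_kernel_comp p i w2
    refine ⟨S.precomp (p ≫ i), kernel p, kernel.ι p, w2, exact_precomp S hS _ w1 hex1,
      (inferInstance : Mono (kernel.ι p)), hker, hfin, ?_, hz, hiso, ?_⟩
    · intro m hm hmk
      exact shift_down (shortExact_kernel p) T m hm (hvK (m + 1) (by omega) (by omega))
    · intro j hj
      cases j with
      | zero => exact hP
      | succ j => exact hadd j (by omega)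

end Stmt4Aux

/-- Let `A` be an Artin algebra, `T, M` finitely generated right `A`-modules
with `^⊥T = add M`, and suppose `inj.dim T ≤ r` for some `r ≥ 2`.  Then every finitely
generated right `A`-module `X` admits an exact sequence
`0 → M_r → M_{r-1} → ⋯ → M_0 → X → 0` with each `M_i ∈ add M` (encoded as an exact
sequence of composable arrows `0 = S⟨0⟩ → S⟨1⟩ → ⋯ → S⟨r+1⟩ → S⟨r+2⟩ ≅ X → S⟨r+3⟩ = 0`
where `S⟨1⟩, …, S⟨r+1⟩` are direct summands of finite direct sums of copies of `M`). -/
theorem stmt_4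
    (R : Type u) [CommRing R] [IsArtinianRing R]
    (A : Type u) [Ring A] [Algebra R A] [Module.Finite R A]
    [HasExt.{u} (ModuleCat.{u} Aᵐᵒᵖ)]
    (T M : Type u) [AddCommGroup T] [Module Aᵐᵒᵖ T] [Module.Finite Aᵐᵒᵖ T]
    [AddCommGroup M] [Module Aᵐᵒᵖ M] [Module.Finite Aᵐᵒᵖ M]
    -- `^⊥T = add M` :
    (hperp : ∀ (X : ModuleCat.{u} Aᵐᵒᵖ), Module.Finite Aᵐᵒᵖ X →
      ((∀ i : ℕ, 1 ≤ i → Subsingleton (Abelian.Ext X (ModuleCat.of Aᵐᵒᵖ T) i)) ↔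
        (∃ (n : ℕ) (f : X →ₗ[Aᵐᵒᵖ] (Fin n → M)) (g : (Fin n → M) →ₗ[Aᵐᵒᵖ] X),
          g ∘ₗ f = LinearMap.id)))
    (r : ℕ) (hr : 2 ≤ r)
    -- `inj.dim T ≤ r` :
    (hinj : ∀ X : ModuleCat.{u} Aᵐᵒᵖ,
      Subsingleton (Abelian.Ext X (ModuleCat.of Aᵐᵒᵖ T) (r + 1))) :
    ∀ (X : ModuleCat.{u} Aᵐᵒᵖ), Module.Finite Aᵐᵒᵖ X →
      ∃ S : ComposableArrows (ModuleCat.{u} Aᵐᵒᵖ) (r + 3),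
        S.Exact ∧
        IsZero (S.obj ⟨0, by omega⟩) ∧
        IsZero (S.obj ⟨r + 3, by omega⟩) ∧
        Nonempty (S.obj ⟨r + 2, by omega⟩ ≅ X) ∧
        (∀ (j : ℕ) (_ : 1 ≤ j) (_ : j ≤ r + 1),
          ∃ (n : ℕ) (f : S.obj ⟨j, by omega⟩ →ₗ[Aᵐᵒᵖ] (Fin n → M))
            (g : (Fin n → M) →ₗ[Aᵐᵒᵖ] S.obj ⟨j, by omega⟩),
            g ∘ₗ f = LinearMap.id) := by
  intro X hX
  have : IsNoetherianRing Aᵐᵒᵖ := by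
    have : Module.Finite R Aᵐᵒᵖ := Module.Finite.equiv (MulOpposite.opLinearEquiv R)
    exact isNoetherian_of_tower R (inferInstanceAs (IsNoetherian R Aᵐᵒᵖ))
  have hvan := Stmt4Aux.ext_vanish (ModuleCat.of Aᵐᵒᵖ T) r hinj
  obtain ⟨S, K, i, w, hS, hi, hex, hK, hvK, hz, hiso, hadd⟩ :=
    Stmt4Aux.resolution (ModuleCat.of Aᵐᵒᵖ T)
      (fun Y : ModuleCat.{u} Aᵐᵒᵖ => Module.Finite Aᵐᵒᵖ Y)
      (fun Y : ModuleCat.{u} Aᵐᵒᵖ => ∃ (n : ℕ) (f : Y →ₗ[Aᵐᵒᵖ] (Fin n → M))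
        (g : (Fin n → M) →ₗ[Aᵐᵒᵖ] Y), g ∘ₗ f = LinearMap.id)
      (by
        intro K hK
        obtain ⟨n, p, hp⟩ := Module.Finite.exists_fin' Aᵐᵒᵖ K
        have : Projective (ModuleCat.of Aᵐᵒᵖ (Fin n → Aᵐᵒᵖ)) :=
          (IsProjective.iff_projective _).1 inferInstance
        refine ⟨ModuleCat.of Aᵐᵒᵖ (Fin n → Aᵐᵒᵖ), ModuleCat.ofHom p,
          (ModuleCat.epi_iff_surjective _).2 hp, inferInstance, ?_, ?_⟩
        · refine (hperp _ (inferInstanceAs (Module.Finite Aᵐᵒᵖ (Fin n → Aᵐᵒᵖ)))).1 ?_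
          intro i hi
          obtain ⟨m, rfl⟩ := Nat.exists_eq_add_of_le' hi
          exact subsingleton_of_forall_eq 0 fun x => Abelian.Ext.eq_zero_of_projective x
        · exact Module.Finite.of_injective (kernel.ι (ModuleCat.ofHom p)).hom
            ((ModuleCat.mono_iff_injective _).1 inferInstance))
      r X hX
      (fun m hm => by
        obtain ⟨k, rfl⟩ := Nat.exists_eq_add_of_le hm
        exact hvan k X)
      r
  have hKadd := (hperp K hK).1 (fun m hm => hvK m hm (by omega))
  have w0 : (0 : ModuleCat.of Aᵐᵒᵖ PUnit.{u + 1} ⟶ K) ≫ i = 0 := zero_comp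
  have hex0 : (ShortComplex.mk (0 : ModuleCat.of Aᵐᵒᵖ PUnit.{u + 1} ⟶ K) i w0).Exact :=
    (ShortComplex.exact_iff_mono _ rfl).2 hi
  refine ⟨(S.precomp i).precomp (0 : ModuleCat.of Aᵐᵒᵖ PUnit.{u + 1} ⟶ K),
    Stmt4Aux.exact_precomp (S.precomp i) (Stmt4Aux.exact_precomp S hS i w hex) _ w0 hex0,
    ModuleCat.isZero_of_subsingleton (ModuleCat.of Aᵐᵒᵖ PUnit.{u + 1}), hz, hiso, ?_⟩
  intro j h1 hj
  match j, h1, hj with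
  | 1, _, _ => exact hKadd
  | j + 2, _, hj => exact hadd j (by omega)
end

section
/- Let 𝒜 be an abelian category with enough projectives and 𝒞 a resolving subcategory. Let I be a bounded complex of relative injective objects of 𝒞, C ∈ K^-(𝒞) an upper-bounded complex over 𝒞, and t: I → C a quasi-isomorphism. Then there exists a chain map s: C → I with s ∘ t homotopic to the identity of I. -/
open CategoryTheory CategoryTheory.Limits

universe w v u

/-- A full subcategory of an abelian category is *resolving* if it contains all projective
objects and is closed under isomorphisms, extensions, direct summands and kernels of
epimorphisms. -/
def IsResolving {C : Type u} [Category.{v} C] [Abelian C] (P : C → Prop) : Prop :=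
  (∀ X Y : C, (X ≅ Y) → P X → P Y) ∧
  (∀ X : C, Projective X → P X) ∧
  (∀ S : ShortComplex C, S.ShortExact → P S.X₁ → P S.X₃ → P S.X₂) ∧
  (∀ X Y : C, P (X ⊞ Y) → P X) ∧
  (∀ S : ShortComplex C, S.ShortExact → P S.X₂ → P S.X₃ → P S.X₁)

namespace RelInj

open CochainComplex HomComplex Preadditive

variable {𝒜 : Type u} [Category.{v} 𝒜] [Abelian 𝒜]

/-- The short complex `Z^n → K^n → Z^m`. -/
noncomputable abbrev cyc (K : CochainComplex 𝒜 ℤ) (n m p : ℤ) : ShortComplex 𝒜 :=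
  ShortComplex.mk (kernel.ι (K.d n m))
    (kernel.lift (K.d m p) (K.d n m) (K.d_comp_d n m p)) (by
      rw [← cancel_mono (kernel.ι _)]; simp)

lemma epi_lift (K : CochainComplex 𝒜 ℤ) (hK : K.Acyclic) (n m p : ℤ) (h : n + 1 = m)
    (h' : m + 1 = p) : Epi (kernel.lift (K.d m p) (K.d n m) (K.d_comp_d n m p)) := by
  have := hK m
  rw [K.exactAt_iff' n m p (by simp; lia) (by simp; lia)] at this
  exact (ShortComplex.exact_iff_epi_kernel_lift _).1 this

lemma cyc_shortExact (K : CochainComplex 𝒜 ℤ) (hK : K.Acyclic) (n m p : ℤ) (h : n + 1 = m)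
    (h' : m + 1 = p) : (cyc K n m p).ShortExact := by
  have := epi_lift K hK n m p h h'
  refine { exact := ?_, mono_f := ?_, epi_g := ?_ }
  · have : Mono (cyc K n m p).f := by dsimp [cyc]; infer_instance
    apply ShortComplex.exact_of_f_is_kernel
    refine KernelFork.IsLimit.ofι' _ _ (fun {A} k hk => ⟨kernel.lift _ k ?_, ?_⟩)
    · have := hk =≫ kernel.ι (K.d m p)
      simpa [cyc] using this
    · exact kernel.lift_ι _ _ _
  · dsimp [cyc]; infer_instance
  · exact this

lemma cyc_mem (𝒞 : 𝒜 → Prop) (h𝒞 : IsResolving 𝒞) (K : CochainComplex 𝒜 ℤ) (hK : K.Acyclic)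
    (hKC : ∀ n, 𝒞 (K.X n)) (b : ℤ) (hb : ∀ n, b < n → IsZero (K.X n)) (n m : ℤ) (h : n + 1 = m) :
    𝒞 (kernel (K.d n m)) := by
  suffices H : ∀ (k : ℕ) (n m : ℤ), n + 1 = m → b < n + k → 𝒞 (kernel (K.d n m)) from
    H (b + 1 - n).toNat n m h (by lia)
  intro k
  induction k with
  | zero =>
    intro n m h hn
    have hz : IsZero (kernel (K.d n m)) :=
      IsZero.of_mono (kernel.ι (K.d n m)) (hb n (by lia))
    exact h𝒞.2.1 _ hz.projective
  | succ k ih =>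
    intro n m h hn
    exact h𝒞.2.2.2.2 _ (cyc_shortExact K hK n m (m + 1) h rfl) (hKC n)
      (ih m (m + 1) rfl (by push_cast at hn; lia))

lemma extend [HasExt.{w} 𝒜] (S : ShortComplex 𝒜) (hS : S.ShortExact) (J : 𝒜)
    (hJ : Subsingleton (Abelian.Ext S.X₃ J 1)) (v : S.X₁ ⟶ J) : ∃ w : S.X₂ ⟶ J, S.f ≫ w = v := by
  obtain ⟨x, hx⟩ := Abelian.Ext.contravariant_sequence_exact₁ hS J (Abelian.Ext.mk₀ v)
    (add_zero 1) (Subsingleton.elim _ _)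
  obtain ⟨w, rfl⟩ := Abelian.Ext.mk₀_bijective _ _ |>.2 x
  refine ⟨w, (Abelian.Ext.mk₀_bijective _ _).1 ?_⟩
  rw [← hx, Abelian.Ext.mk₀_comp_mk₀]

lemma ext_d [HasExt.{w} 𝒜] (𝒞 : 𝒜 → Prop) (K : CochainComplex 𝒜 ℤ) (hK : K.Acyclic)
    (hZ : ∀ n m : ℤ, n + 1 = m → 𝒞 (kernel (K.d n m)))
    (J : 𝒜) (hJ : ∀ X, 𝒞 X → Subsingleton (Abelian.Ext X J 1))
    (n m p : ℤ) (h : n + 1 = m) (h' : m + 1 = p) (u : K.X m ⟶ J) (hu : K.d n m ≫ u = 0) :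
    ∃ β : K.X p ⟶ J, K.d m p ≫ β = u := by
  have hS := cyc_shortExact K hK m p (p + 1) h' rfl
  have := epi_lift K hK n m p h h'
  have := hS.epi_g
  have hu' : kernel.ι (K.d m p) ≫ u = 0 := by
    rw [← cancel_epi (kernel.lift (K.d m p) (K.d n m) (K.d_comp_d n m p))]
    simpa [cyc] using hu
  obtain ⟨v, hv⟩ := hS.exact.desc' u hu'
  obtain ⟨β, hβ⟩ := extend _ (cyc_shortExact K hK p (p + 1) (p + 2) rfl (by lia)) J
    (hJ _ (hZ _ _ (by lia))) v
  refine ⟨β, ?_⟩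
  rw [← hv, ← hβ]
  exact (kernel.lift_ι_assoc (K.d p (p + 1)) (K.d m p) (K.d_comp_d m p (p + 1)) β).symm

lemma aux {K L : CochainComplex 𝒜 ℤ}
    (f : K ⟶ L) (α : Cochain K L (-1)) (n m : ℤ) (hnm : n + 1 = m)
    (hE : ∀ (u : K.X (n + 1) ⟶ L.X (n + 1)), K.d n (n + 1) ≫ u = 0 →
      ∃ β : K.X (n + 2) ⟶ L.X (n + 1), K.d (n + 1) (n + 2) ≫ β = u)
    (hα : (δ (-1) 0 α).EqUpTo (Cochain.ofHom f) n) :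
    ∃ (h : K.X (n + 2) ⟶ L.X (n + 1)),
      (δ (-1) 0 (α + Cochain.single h (-1))).EqUpTo (Cochain.ofHom f) m := by
  subst hnm
  let u := f.f (n + 1) - α.v (n + 1) n (by lia) ≫ L.d n (n + 1) -
    K.d (n + 1) (n + 2) ≫ α.v (n + 2) (n + 1) (by lia)
  have hu : K.d n (n + 1) ≫ u = 0 := by
    have eq := hα n n (add_zero n) (by rfl)
    simp only [δ_v (-1) 0 (neg_add_cancel 1) α n n (add_zero _) (n - 1) (n + 1)
      (by lia) (by lia), Int.negOnePow_zero, one_smul, Cochain.ofHom_v] at eq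
    simp only [u, comp_sub, HomologicalComplex.d_comp_d_assoc, zero_comp,
      ← f.comm, ← eq, add_comp, Category.assoc, L.d_comp_d, comp_zero, zero_add, sub_self]
  obtain ⟨β, hβ⟩ := hE u hu
  refine ⟨β, ?_⟩
  intro p q hpq hp
  obtain rfl : p = q := by lia
  obtain hp | rfl := hp.lt_or_eq
  · rw [δ_add, Cochain.add_v, hα p p (by lia) (by lia), add_eq_left,
      δ_v (-1) 0 (neg_add_cancel 1) _ p p hpq (p - 1) (p + 1) rfl rfl,
      Cochain.single_v_eq_zero _ _ _ _ _ (by lia),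
      Cochain.single_v_eq_zero _ _ _ _ _ (by lia)]
    simp
  · rw [δ_v (-1) 0 (neg_add_cancel 1) _ (n + 1) (n + 1) (by lia) n (n + 2)
      (by lia) (by lia), Cochain.add_v,
      Cochain.single_v_eq_zero _ _ _ _ _ (by lia)]
    simp [hβ, u]

open Cochain.InductionUp in
lemma null {K L : CochainComplex 𝒜 ℤ} (f : K ⟶ L) (d : ℤ)
    (hL : ∀ n < d, IsZero (L.X n))
    (hE : ∀ (n : ℤ) (u : K.X (n + 1) ⟶ L.X (n + 1)), K.d n (n + 1) ≫ u = 0 →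
      ∃ β : K.X (n + 2) ⟶ L.X (n + 1), K.d (n + 1) (n + 2) ≫ β = u) :
    Nonempty (Homotopy f 0) := by
  let X (n : ℕ) : Set (Cochain K L (-1)) :=
    Set.ofPred (fun α => (δ (-1) 0 α).EqUpTo (Cochain.ofHom f) (n + d - 1))
  let x₀ : X 0 := ⟨0, fun p q hpq hp ↦
    IsZero.eq_of_tgt (hL _ (by lia)) _ _⟩
  let φ (n : ℕ) (α : X n) : X (n + 1) :=
    ⟨_, (aux f α.1 (n + d - 1) ((n + 1 : ℕ) + d - 1)
      (by lia) (hE _) α.2).choose_spec⟩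
  have hφ (k : ℕ) (x : X k) : (φ k x).1.EqUpTo x.1 (d + k) := fun p q hpq hp => by
    dsimp [φ]
    rw [add_eq_left, Cochain.single_v_eq_zero _ _ _ _ _ (by lia)]
  refine ⟨(Cochain.equivHomotopy f 0).symm ⟨limitSequence φ hφ x₀, ?_⟩⟩
  rw [Cochain.ofHom_zero, add_zero]
  ext n
  let k₀ := (n - d + 1).toNat
  rw [← (sequence φ x₀ k₀).2 n n (add_zero n) (by lia),
    δ_v (-1) 0 (neg_add_cancel 1) _ n n (by lia) (n - 1) (n + 1) rfl (by lia),
    δ_v (-1) 0 (neg_add_cancel 1) _ n n (by lia) (n - 1) (n + 1) rfl (by lia),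
    limitSequence_eqUpTo φ hφ x₀ k₀ n (n - 1) (by lia) (by lia),
    limitSequence_eqUpTo φ hφ x₀ k₀ (n + 1) n (by lia) (by lia)]

lemma acyclic_cone {I C : CochainComplex 𝒜 ℤ} (t : I ⟶ C) (ht : QuasiIso t) :
    (mappingCone t).Acyclic := by
  rw [← HomotopyCategory.quotient_obj_mem_subcategoryAcyclic_iff_acyclic]
  have h : HomotopyCategory.quasiIso 𝒜 (ComplexShape.up ℤ)
      ((HomotopyCategory.quotient _ _).map t) := by
    rw [HomotopyCategory.quotient_map_mem_quasiIso_iff]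
    exact ht
  rw [HomotopyCategory.quasiIso_eq_trW_subcategoryAcyclic] at h
  exact ((HomotopyCategory.subcategoryAcyclic 𝒜).trW_iff_of_distinguished
    _ (HomotopyCategory.mappingCone_triangleh_distinguished t)).1 h

end RelInj

/-- Let `𝒜` be an abelian category with enough projectives and `𝒞` a resolving
subcategory.  Let `I` be a bounded cochain complex of relative injective objects of `𝒞`
(objects `J ∈ 𝒞` with `Ext^1(X, J) = 0` for all `X ∈ 𝒞`), `C` an upper-bounded cochain
complex with all terms in `𝒞`, and `t : I ⟶ C` a quasi-isomorphism.  Then there is a chain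
map `s : C ⟶ I` with `s ∘ t` homotopic to the identity of `I`. -/
theorem stmt_7 {𝒜 : Type u} [Category.{v} 𝒜] [Abelian 𝒜] [EnoughProjectives 𝒜]
    [HasExt.{w} 𝒜] (𝒞 : 𝒜 → Prop) (h𝒞 : IsResolving 𝒞)
    (I C : CochainComplex 𝒜 ℤ)
    (hIbdd : ∃ a b : ℤ, ∀ n : ℤ, (n < a ∨ b < n) → IsZero (I.X n))
    (hIC : ∀ n : ℤ, 𝒞 (I.X n))
    (hIinj : ∀ n : ℤ, ∀ X : 𝒜, 𝒞 X → Subsingleton (Abelian.Ext X (I.X n) 1))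
    (hCbdd : ∃ b : ℤ, ∀ n : ℤ, b < n → IsZero (C.X n))
    (hCC : ∀ n : ℤ, 𝒞 (C.X n))
    (t : I ⟶ C) (ht : QuasiIso t) :
    ∃ s : C ⟶ I, Nonempty (Homotopy (t ≫ s) (𝟙 I)) := by
  obtain ⟨a, b, hab⟩ := hIbdd
  obtain ⟨b', hb'⟩ := hCbdd
  have hK := RelInj.acyclic_cone t ht
  have hKC : ∀ n, 𝒞 ((CochainComplex.mappingCone t).X n) := fun n =>
    h𝒞.1 _ _ (HomologicalComplex.homotopyCofiber.XIsoBiprod t n (n + 1) rfl).symm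
      (h𝒞.2.2.1 _ (ShortComplex.Splitting.ofHasBinaryBiproduct (I.X (n + 1)) (C.X n)).shortExact
        (hIC _) (hCC _))
  have hZ := RelInj.cyc_mem 𝒞 h𝒞 _ hK hKC (max b b') (fun n hn => by
    rw [CochainComplex.mappingCone.isZero_X_iff]
    exact ⟨hab _ (Or.inr (by grind)), hb' _ (by grind)⟩)
  obtain ⟨H⟩ := RelInj.null (CochainComplex.mappingCone.triangle t).mor₃ (a - 1)
    (fun n hn => hab (n + 1) (Or.inl (by lia)))
    (fun n u hu => RelInj.ext_d 𝒞 _ hK hZ _ (hIinj (n + 1 + 1)) n _ _ rfl (by lia) u hu)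
  have h0 := HomotopyCategory.eq_of_homotopy _ _ H
  have hT := HomotopyCategory.mappingCone_triangleh_distinguished t
  have hm : Mono ((HomotopyCategory.quotient _ _).map t) := by
    refine Pretriangulated.Triangle.mono₁ _ hT ?_
    change (HomotopyCategory.quotient 𝒜 (ComplexShape.up ℤ)).map
      (CochainComplex.mappingCone.triangle t).mor₃ ≫ _ = 0
    rw [h0, Functor.map_zero, zero_comp]
  have := isSplitMono_of_mono ((HomotopyCategory.quotient 𝒜 (ComplexShape.up ℤ)).map t)
  obtain ⟨s, hs⟩ := (HomotopyCategory.quotient _ _).map_surjective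
    (retraction ((HomotopyCategory.quotient 𝒜 (ComplexShape.up ℤ)).map t))
  refine ⟨s, ⟨HomotopyCategory.homotopyOfEq _ _ ?_⟩⟩
  rw [Functor.map_comp, hs, IsSplitMono.id, CategoryTheory.Functor.map_id]
end

section
/- Let 𝒜 be an abelian category with enough projective objects that has arbitrary (infinite) direct sums, and let P be an object of the bounded derived category D^b(𝒜) which is perfect, i.e., for every Y ∈ D^b(𝒜) only finitely many i ∈ ℤ satisfy Hom_{D^b(𝒜)}(P, Y[i]) ≠ 0. Then P is isomorphic in D^b(𝒜) to a bounded complex of projective objects. -/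
open CategoryTheory CategoryTheory.Limits

universe w v u

namespace PerfAux

open CochainComplex HomologicalComplex Opposite

variable {C : Type u} [Category.{v} C] [Abelian C]

set_option maxHeartbeats 1000000 in
lemma quasiIso_of_op {K L : CochainComplex C ℤ} (g : K ⟶ L)
    (hg : QuasiIso ((CochainComplex.opEquivalence C).functor.map g.op)) : QuasiIso g := by
  rw [quasiIso_iff]
  intro n
  obtain ⟨m, rfl⟩ : ∃ m : ℤ, n = -m := ⟨-n, by simp⟩
  have h := hg.quasiIsoAt m
  rw [quasiIsoAt_iff' _ (m - 1) m (m + 1) (by simp) (by simp)] at h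
  rw [quasiIsoAt_iff' _ (-(m + 1)) (-m) (-(m - 1)) (by grind [CochainComplex.prev])
    (by grind [CochainComplex.next])]
  rw [← ShortComplex.quasiIso_opMap_iff]
  exact h

lemma exists_proj_resolution [EnoughProjectives C] (P : CochainComplex C ℤ) (b : ℤ)
    [P.IsStrictlyLE b] :
    ∃ (R : CochainComplex C ℤ) (g : R ⟶ P), QuasiIso g ∧ (∀ n, Projective (R.X n)) ∧
      R.IsStrictlyLE b := by
  let e := CochainComplex.opEquivalence C
  have : (e.functor.obj (op P)).IsStrictlyGE (-b) := by
    rw [isStrictlyGE_iff]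
    intro i hi
    exact (P.isZero_of_isStrictlyLE b (-i) (by lia)).op
  obtain ⟨L, i, hi, hL, hL'⟩ :=
    CochainComplex.Plus.modelCategoryQuillen.exists_quasiIso_injective (e.functor.obj (op P)) (-b)
  let R : CochainComplex C ℤ := (e.inverse.obj L).unop
  let α : e.functor.obj (op R) ≅ L := e.counitIso.app L
  obtain ⟨g, hg⟩ := e.functor.map_surjective (i ≫ α.inv)
  refine ⟨R, g.unop, quasiIso_of_op _ ?_, fun n ↦ ?_, ?_⟩
  · change QuasiIso (e.functor.map g)
    rw [hg]
    infer_instance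
  · have := hL (-n)
    change Projective ((L.X (-n)).unop)
    infer_instance
  · rw [isStrictlyLE_iff]
    intro n hn
    exact (L.isZero_of_isStrictlyGE (-b) (-n) (by lia)).unop

lemma Qh_map_eq_zero [HasDerivedCategory.{w} C] {K L : CochainComplex C ℤ} (φ : K ⟶ L)
    (h : DerivedCategory.Q.map φ = 0) :
    DerivedCategory.Qh.map ((HomotopyCategory.quotient _ _).map φ) = 0 := by
  have := (DerivedCategory.quotientCompQhIso C).hom.naturality φ
  rw [h, comp_zero] at this
  exact (cancel_mono _).1 (this.trans zero_comp.symm)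

lemma projective_opcycles (R : CochainComplex C ℤ) [HasDerivedCategory.{w} C] [R.IsKProjective]
    (n : ℤ) [Projective (R.X (n + 1))]
    (h : DerivedCategory.Q.map (mkHomToSingle (R.pOpcycles n) (by simp) :
      R ⟶ (single C _ n).obj (R.opcycles n)) = 0) :
    Projective (R.opcycles n) := by
  set φ : R ⟶ (single C _ n).obj (R.opcycles n) :=
    mkHomToSingle (R.pOpcycles n) (by simp) with hφ
  have h1 : (HomotopyCategory.quotient _ _).map φ = 0 := by
    apply (CochainComplex.IsKProjective.Qh_map_bijective R _).injective
    rw [Functor.map_zero]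
    exact Qh_map_eq_zero φ h
  obtain ⟨H⟩ := (HomotopyCategory.quotient_map_eq_zero_iff φ).1 h1
  have h2 := H.comm n
  rw [dNext_eq _ (show (ComplexShape.up ℤ).Rel n (n + 1) by simp),
    prevD_eq _ (show (ComplexShape.up ℤ).Rel (n - 1) n by simp)] at h2
  have h3 : φ.f n = R.pOpcycles n ≫ (singleObjXSelf _ n (R.opcycles n)).inv :=
    mkHomToSingle_f _ _
  rw [h3] at h2
  simp only [single_obj_d, comp_zero, add_zero, zero_f] at h2
  have h4 : R.fromOpcycles n (n + 1) ≫ H.hom (n + 1) n ≫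
      (singleObjXSelf (ComplexShape.up ℤ) n (R.opcycles n)).hom = 𝟙 _ := by
    rw [← cancel_epi (R.pOpcycles n)]
    simp [← reassoc_of% h2]
  exact (Retract.mk _ _ h4).projective

end PerfAux

open HomologicalComplex in
/-- Let `𝒜` be an abelian category with enough projectives having arbitrary
direct sums, and let `P` be an object of the bounded derived category `D^b(𝒜)` (a bounded
cochain complex, viewed in the derived category) which is perfect: for every `Y ∈ D^b(𝒜)`
(every bounded cochain complex `Y`) only finitely many `i ∈ ℤ` satisfy
`Hom_{D(𝒜)}(P, Y[i]) ≠ 0`.  Then `P` is isomorphic in the derived category to a bounded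
cochain complex of projective objects. -/
theorem stmt_9 {𝒜 : Type u} [Category.{v} 𝒜] [Abelian 𝒜] [EnoughProjectives 𝒜]
    [HasCoproducts.{v} 𝒜] [HasDerivedCategory.{w} 𝒜]
    (P : CochainComplex 𝒜 ℤ)
    (hPbdd : ∃ a b : ℤ, ∀ n : ℤ, (n < a ∨ b < n) → IsZero (P.X n))
    (hperf : ∀ Y : CochainComplex 𝒜 ℤ,
      (∃ a b : ℤ, ∀ n : ℤ, (n < a ∨ b < n) → IsZero (Y.X n)) →
      {i : ℤ | ∃ f : DerivedCategory.Q.obj P ⟶ (DerivedCategory.Q.obj Y)⟦i⟧,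
        f ≠ 0}.Finite) :
    ∃ Pb : CochainComplex 𝒜 ℤ,
      (∃ a b : ℤ, ∀ n : ℤ, (n < a ∨ b < n) → IsZero (Pb.X n)) ∧
      (∀ n : ℤ, Projective (Pb.X n)) ∧
      Nonempty (DerivedCategory.Q.obj P ≅ DerivedCategory.Q.obj Pb) := by
  obtain ⟨a, b, hab⟩ := hPbdd
  have : P.IsStrictlyLE b := by
    rw [CochainComplex.isStrictlyLE_iff]; exact fun i hi ↦ hab i (Or.inr hi)
  have : P.IsStrictlyGE a := by
    rw [CochainComplex.isStrictlyGE_iff]; exact fun i hi ↦ hab i (Or.inl hi)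
  obtain ⟨R, g, hg, hR, hRb⟩ := PerfAux.exists_proj_resolution P b
  have hRK : R.IsKProjective := CochainComplex.isKProjective_of_projective R b
  have hRa : R.IsGE a := by
    rw [CochainComplex.isGE_iff]
    intro i hi
    rw [exactAt_iff_of_quasiIsoAt g i]
    exact P.exactAt_of_isGE a i hi
  let M : ULift.{v} ℕ → 𝒜 := fun k ↦ R.opcycles (-(k.down : ℤ))
  let Y : CochainComplex 𝒜 ℤ := (CochainComplex.singleFunctor 𝒜 0).obj (∐ M)
  have hfin := hperf Y ⟨0, 0, by
    rintro n (hn | hn)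
    · exact Y.isZero_of_isStrictlyGE 0 n hn
    · exact Y.isZero_of_isStrictlyLE 0 n hn⟩
  obtain ⟨N, hN⟩ := hfin.bddAbove
  obtain ⟨k, hk1, hk2⟩ : ∃ k : ℕ, N < k ∧ -(k : ℤ) ≤ a :=
    ⟨(max (N + 1) (-a)).toNat, by lia, by lia⟩
  let n : ℤ := -(k : ℤ)
  have hzero : DerivedCategory.Q.map (mkHomToSingle (R.pOpcycles n) (by simp) :
      R ⟶ (single 𝒜 _ n).obj (R.opcycles n)) = 0 := by
    let φ : R ⟶ (CochainComplex.singleFunctor 𝒜 n).obj (R.opcycles n) :=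
      mkHomToSingle (R.pOpcycles n) (by simp)
    change DerivedCategory.Q.map φ = 0
    let s : (CochainComplex.singleFunctor 𝒜 n).obj (R.opcycles n) ⟶
        (CochainComplex.singleFunctor 𝒜 n).obj (∐ M) :=
      (CochainComplex.singleFunctor 𝒜 n).map (Sigma.ι M ⟨k⟩)
    have : IsSplitMono s := by dsimp only [s]; infer_instance
    let σ : (CochainComplex.singleFunctor 𝒜 n).obj (∐ M) ≅ Y⟦(k : ℤ)⟧ :=
      (((CochainComplex.singleFunctors 𝒜).shiftIso (k : ℤ) n 0 (by simp [n])).app (∐ M)).symm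
    let τ := (DerivedCategory.Q (C := 𝒜)).commShiftIso (k : ℤ)
    by_contra hne
    have hmem : (k : ℤ) ∈ {i : ℤ | ∃ f : DerivedCategory.Q.obj P ⟶
        (DerivedCategory.Q.obj Y)⟦i⟧, f ≠ 0} := by
      refine ⟨inv (DerivedCategory.Q.map g) ≫ DerivedCategory.Q.map φ ≫
        DerivedCategory.Q.map s ≫ DerivedCategory.Q.map σ.hom ≫ τ.hom.app Y, fun h0 ↦ hne ?_⟩
      rw [← cancel_epi (inv (DerivedCategory.Q.map g)),
        ← cancel_mono (DerivedCategory.Q.map s),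
        ← cancel_mono (DerivedCategory.Q.map σ.hom ≫ τ.hom.app Y)]
      simpa using h0
    exact absurd (hN hmem) (by lia)
  have hproj : Projective (R.opcycles n) := PerfAux.projective_opcycles R n hzero
  have : R.IsGE n := R.isGE_of_ge n a hk2
  refine ⟨R.truncGE n, ⟨n, max b n, ?_⟩, fun q ↦ ?_,
    ⟨(asIso (DerivedCategory.Q.map g)).symm ≪≫ asIso (DerivedCategory.Q.map (R.πTruncGE n))⟩⟩
  · rintro i (hi | hi)
    · exact (R.truncGE n).isZero_of_isStrictlyGE n i hi
    · exact (R.isZero_of_isStrictlyLE b i (by lia)).of_iso (R.truncGEXIso n i (by lia))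
  · obtain h | rfl | h := lt_trichotomy q n
    · exact (CochainComplex.isZero_of_isStrictlyGE _ n _ h).projective
    · exact Projective.of_iso (R.truncGEXIsoOpcycles n).symm hproj
    · exact Projective.of_iso (R.truncGEXIso n q h).symm (hR q)
end

section
/- Let 𝒜 be an abelian category with enough projectives that is finitely filtrated: there exist finitely many objects S_1, …, S_m such that every nonzero object X admits a finite filtration 0 = X_0 ↪ X_1 ↪ ⋯ ↪ X_n = X with each successive quotient isomorphic to some S_j. Then every perfect object of D^b(𝒜) lies in K^b(𝒫), i.e., D^b_perf(𝒜) = K^b(𝒫). -/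
open CategoryTheory CategoryTheory.Limits

universe w v u

set_option linter.unusedSectionVars false

namespace PerfAux

open DerivedCategory Pretriangulated

variable {A : Type u} [Category.{v} A] [Abelian A] [HasDerivedCategory.{w} A]

/-- `X` has no nonzero maps to an object of `A` placed in a degree `n ≤ N`. -/
def Van (X : DerivedCategory A) (N : ℤ) : Prop :=
  ∀ (M : A) (n : ℤ), n ≤ N → ∀ f : X ⟶ (singleFunctor A n).obj M, f = 0

/-- `X` is isomorphic to a bounded complex of projectives. -/
def IsKb (X : DerivedCategory A) : Prop :=
  ∃ Pb : CochainComplex A ℤ,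
      (∃ a b : ℤ, ∀ n : ℤ, (n < a ∨ b < n) → IsZero (Pb.X n)) ∧
      (∀ n : ℤ, Projective (Pb.X n)) ∧
      Nonempty (X ≅ DerivedCategory.Q.obj Pb)

lemma Van.of_iso {X Y : DerivedCategory A} {N : ℤ} (h : Van X N) (e : X ≅ Y) : Van Y N := by
  intro M n hn f
  rw [← cancel_epi e.hom, comp_zero]
  exact h M n hn _

lemma IsKb.of_iso {X Y : DerivedCategory A} (h : IsKb X) (e : X ≅ Y) : IsKb Y := by
  obtain ⟨K, h1, h2, ⟨e'⟩⟩ := h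
  exact ⟨K, h1, h2, ⟨e.symm ≪≫ e'⟩⟩

lemma exists_lift {K L : CochainComplex A ℤ} [K.IsKProjective]
    (f : Q.obj K ⟶ Q.obj L) : ∃ g : K ⟶ L, Q.map g = f := by
  obtain ⟨g, hg⟩ := (CochainComplex.IsKProjective.Qh_map_bijective K
    ((HomotopyCategory.quotient _ _).obj L)).surjective
    ((quotientCompQhIso A).hom.app K ≫ f ≫ (quotientCompQhIso A).inv.app L)
  obtain ⟨g, rfl⟩ := (HomotopyCategory.quotient _ _).map_surjective g
  refine ⟨g, ?_⟩
  rw [← cancel_epi ((quotientCompQhIso A).hom.app K), ← quotientCompQhIso_hom_naturality, hg]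
  simp

lemma kproj_of_bdd {K : CochainComplex A ℤ}
    (hb : ∃ a b : ℤ, ∀ n : ℤ, (n < a ∨ b < n) → IsZero (K.X n))
    (hp : ∀ n : ℤ, Projective (K.X n)) : K.IsKProjective := by
  obtain ⟨a, b, h⟩ := hb
  have : K.IsStrictlyLE b := by
    rw [CochainComplex.isStrictlyLE_iff]
    intro i hi
    exact h i (Or.inr hi)
  exact CochainComplex.isKProjective_of_projective K b

lemma single_bdd (P : A) (b : ℤ) : ∃ a c : ℤ, ∀ n : ℤ, (n < a ∨ c < n) →
    IsZero (((HomologicalComplex.single A (ComplexShape.up ℤ) b).obj P).X n) :=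
  ⟨b, b, fun n hn => HomologicalComplex.isZero_single_obj_X _ _ _ _ (by omega)⟩

lemma single_proj (P : A) [Projective P] (b n : ℤ) :
    Projective (((HomologicalComplex.single A (ComplexShape.up ℤ) b).obj P).X n) := by
  by_cases h : n = b
  · subst h
    exact Projective.of_iso (HomologicalComplex.singleObjXSelf _ _ P).symm inferInstance
  · have := HomologicalComplex.isZero_single_obj_X (ComplexShape.up ℤ) b P n h
    exact Projective.of_iso ((isZero_zero A).iso this) inferInstance

lemma hom_single_proj (P M : A) [Projective P] (b n : ℤ) (hn : n ≠ b)
    (f : (singleFunctor A b).obj P ⟶ (singleFunctor A n).obj M) : f = 0 := by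
  have := kproj_of_bdd (single_bdd P b) (single_proj P b)
  obtain ⟨g, rfl⟩ := exists_lift (K := (HomologicalComplex.single A (ComplexShape.up ℤ) b).obj P)
    (L := (HomologicalComplex.single A (ComplexShape.up ℤ) n).obj M) f
  have : g = 0 := by
    apply HomologicalComplex.hom_ext
    intro i
    by_cases h : i = b
    · exact (HomologicalComplex.isZero_single_obj_X _ _ _ _ (by omega)).eq_of_tgt _ _
    · exact (HomologicalComplex.isZero_single_obj_X _ _ _ _ h).eq_of_src _ _
  rw [this, Functor.map_zero]
  rfl

/-- Shift of a bounded complex of projectives, and extension. -/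
lemma IsKb.ext {T : Triangle (DerivedCategory A)} (hT : T ∈ distTriang _)
    (h₁ : IsKb T.obj₁) (h₃ : IsKb T.obj₃) : IsKb T.obj₂ := by
  obtain ⟨K, ⟨a, b, hK⟩, hKp, ⟨eK⟩⟩ := h₁
  obtain ⟨L, ⟨c, d, hL⟩, hLp, ⟨eL⟩⟩ := h₃
  have : L.IsKProjective := kproj_of_bdd ⟨c, d, hL⟩ hLp
  let e : T.invRotate.obj₁ ≅ Q.obj (L⟦(-1 : ℤ)⟧) :=
    (shiftFunctor (DerivedCategory A) (-1 : ℤ)).mapIso eL ≪≫ (Q.commShiftIso (-1 : ℤ)).symm.app L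
  obtain ⟨g, hg⟩ := exists_lift (e.inv ≫ T.invRotate.mor₁ ≫ eK.hom)
  have iso := isoTriangleOfIso₁₂ T.invRotate _ (inv_rot_of_distTriang _ hT)
    (mappingCone_triangle_distinguished g) e eK (by
      change _ = _ ≫ Q.map g
      rw [hg, Iso.hom_inv_id_assoc]
      rfl)
  have hX : ∀ n, (CochainComplex.mappingCone g).X n ≅ L.X n ⊞ K.X n := fun n =>
    HomologicalComplex.homotopyCofiber.XIsoBiprod g n (n + 1) rfl ≪≫
      biprod.mapIso (L.XIsoOfEq (by dsimp; omega)) (Iso.refl _)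
  refine ⟨CochainComplex.mappingCone g, ⟨min a c, max b d, fun n hn => ?_⟩, fun n => ?_,
    ⟨Triangle.π₃.mapIso iso⟩⟩
  · refine IsZero.of_iso ?_ (hX n)
    have := hK n (by omega)
    have := hL n (by omega)
    rw [biprod_isZero_iff]
    exact ⟨‹_›, ‹_›⟩
  · have := hKp n
    have := hLp n
    exact Projective.of_iso (hX n).symm inferInstance

lemma IsKb.single (P : A) [Projective P] (b : ℤ) : IsKb ((singleFunctor A b).obj P) :=
  ⟨_, single_bdd P b, single_proj P b, ⟨Iso.refl _⟩⟩

/-- The triangle in the derived category attached to a short exact sequence in degree `n`. -/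
lemma exists_single_triangle {S : ShortComplex A} (hS : S.ShortExact) (n : ℤ) :
    ∃ δ : (singleFunctor A n).obj S.X₃ ⟶ ((singleFunctor A n).obj S.X₁)⟦(1 : ℤ)⟧,
      Triangle.mk ((singleFunctor A n).map S.f) ((singleFunctor A n).map S.g) δ ∈
        distTriang (DerivedCategory A) :=
  ⟨_, triangleOfSES_distinguished
    (hS.map_of_exact (HomologicalComplex.single A (ComplexShape.up ℤ) n))⟩

lemma base [EnoughProjectives A] (X : DerivedCategory A) (b : ℤ) [X.IsGE b] [X.IsLE b]
    (hX : Van X (b - 1)) : IsKb X := by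
  obtain ⟨Y, ⟨e⟩⟩ := exists_iso_singleFunctor_obj_of_isGE_of_isLE X b
  have hY := hX.of_iso e
  suffices Projective Y from (IsKb.single Y b).of_iso e.symm
  let S : ShortComplex A := ShortComplex.mk (kernel.ι (Projective.π Y)) (Projective.π Y) (by simp)
  have hS : S.ShortExact :=
    { exact := ShortComplex.exact_of_f_is_kernel _ (kernelIsKernel _)
      mono_f := by dsimp [S]; infer_instance
      epi_g := by dsimp [S]; infer_instance }
  obtain ⟨δ, hδ⟩ := exists_single_triangle hS b
  have h0 : δ = 0 := by
    let i := ((singleFunctors A).shiftIso (1 : ℤ) (b - 1) b (by omega)).app S.X₁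
    have := hY S.X₁ (b - 1) le_rfl (δ ≫ i.hom)
    rwa [← cancel_mono i.hom, zero_comp]
  obtain ⟨s, hs⟩ := Triangle.coyoneda_exact₃ _ hδ (𝟙 ((singleFunctor A b).obj Y))
    (by rw [h0]; exact comp_zero)
  obtain ⟨s, rfl⟩ := (singleFunctor A b).map_surjective s
  have hs' : s ≫ Projective.π Y = 𝟙 Y := by
    apply (singleFunctor A b).map_injective
    rw [CategoryTheory.Functor.map_comp, CategoryTheory.Functor.map_id]
    exact hs.symm
  refine ⟨fun {E Z} f q _ => ⟨s ≫ Projective.factorThru (Projective.π Y ≫ f) q, ?_⟩⟩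
  rw [Category.assoc, Projective.factorThru_comp, ← Category.assoc, hs', Category.id_comp]

lemma step [EnoughProjectives A] (X : DerivedCategory A) (b : ℤ) [X.IsLE b] :
    ∃ (P : A) (_ : Projective P) (f : (singleFunctor A b).obj P ⟶ X),
      Epi ((homologyFunctor A b).map f) := by
  obtain ⟨K, _, ⟨e⟩⟩ := exists_iso_Q_obj_of_isLE X b
  have hz : ∀ k, (ComplexShape.up ℤ).Rel b k → K.d b k = 0 := fun k hk =>
    (K.isZero_of_isStrictlyLE b k (by simp at hk; omega)).eq_of_tgt _ _
  let φ : (HomologicalComplex.single A (ComplexShape.up ℤ) b).obj (Projective.over (K.X b)) ⟶ K :=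
    HomologicalComplex.mkHomFromSingle (Projective.π (K.X b)) (fun k hk => by rw [hz k hk, comp_zero])
  have h1 : Epi (φ.f b) := by
    simp only [φ, HomologicalComplex.mkHomFromSingle_f]
    infer_instance
  have hK : IsIso (K.iCycles b) := K.isIso_iCycles b (b + 1) (by simp) (hz _ rfl)
  have h2 : Epi (HomologicalComplex.cyclesMap φ b) := by
    have : Epi (HomologicalComplex.cyclesMap φ b ≫ K.iCycles b) := by
      rw [HomologicalComplex.cyclesMap_i]
      have : IsIso (((HomologicalComplex.single A (ComplexShape.up ℤ) b).obj
        (Projective.over (K.X b))).iCycles b) :=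
        HomologicalComplex.isIso_iCycles _ b (b + 1) (by simp) (by simp)
      infer_instance
    have := epi_comp (HomologicalComplex.cyclesMap φ b ≫ K.iCycles b) (inv (K.iCycles b))
    rwa [Category.assoc, IsIso.hom_inv_id, Category.comp_id] at this
  have h3 : Epi (HomologicalComplex.homologyMap φ b) := by
    have : Epi (HomologicalComplex.homologyπ _ b ≫ HomologicalComplex.homologyMap φ b) := by
      rw [HomologicalComplex.homologyπ_naturality]
      infer_instance
    exact epi_of_epi (HomologicalComplex.homologyπ _ b) _
  have h4 : Epi ((homologyFunctor A b).map (Q.map φ)) := by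
    have := homologyFunctorFactors_hom_naturality φ b
    have h6 : Epi ((homologyFunctorFactors A b).hom.app _ ≫
        HomologicalComplex.homologyMap φ b) := epi_comp' inferInstance h3
    rw [← this] at h6
    let i := (homologyFunctorFactors A b).app K
    have h9 : Epi (((homologyFunctor A b).map (Q.map φ) ≫ i.hom) ≫ i.inv) :=
      epi_comp' h6 inferInstance
    rwa [Category.assoc, Iso.hom_inv_id, Category.comp_id] at h9
  refine ⟨Projective.over (K.X b), inferInstance, Q.map φ ≫ e.inv, ?_⟩
  have h7 := (homologyFunctor A b).map_comp (Q.map φ) e.inv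
  have h8 : Epi ((homologyFunctor A b).map (Q.map φ ≫ e.inv)) := by
    rw [h7]
    exact epi_comp' h4 inferInstance
  exact h8

lemma isZero_of_exact {S : ShortComplex A} (h : S.Exact) (h1 : S.f = 0) (h3 : S.g = 0) :
    IsZero S.X₂ := by
  have := h.mono_g h1
  rw [IsZero.iff_id_eq_zero, ← cancel_mono S.g, h3, comp_zero, comp_zero]

lemma main_aux [EnoughProjectives A] (a N : ℤ) (haN : N + 1 ≤ a) (k : ℕ) : ∀ (X : DerivedCategory A) (b : ℤ),
    b ≤ min a (N + 1) + k → X.IsLE b → X.IsGE (min a b) → Van X N → IsKb X := by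
  induction k with
  | zero =>
    intro X b hb _ hge hV
    have : min a b = b := by omega
    rw [this] at hge
    exact base X b (fun M n hn f => hV M n (by omega) f)
  | succ k ih =>
    intro X b hb hle hge hV
    by_cases hb' : b ≤ min a (N + 1) + k
    · exact ih X b hb' hle hge hV
    have := hle
    obtain ⟨P, _, f, hf⟩ := step X b
    obtain ⟨C, g, h, hT⟩ := distinguished_cocone_triangle f
    have hX' := (isLE_iff X b).1 hle
    have hX'' := (isGE_iff X (min a b)).1 hge
    have hP' := (isLE_iff ((singleFunctor A b).obj P) b).1 inferInstance
    have hP'' := (isGE_iff ((singleFunctor A b).obj P) b).1 inferInstance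
    suffices IsKb C from IsKb.ext hT (IsKb.single P b) this
    refine ih C (b - 1) (by push_cast at hb; omega) ?_ ?_ ?_
    · rw [isLE_iff]
      intro i hi
      refine isZero_of_exact (HomologySequence.exact₃ _ hT i (i + 1) rfl) ?_ ?_
      · by_cases hib : i = b
        · subst hib
          exact (HomologySequence.epi_homologyMap_mor₁_iff _ hT i).1 hf
        · exact (hX' i (by omega)).eq_of_src _ _
      · exact (hP' (i + 1) (by omega)).eq_of_tgt _ _
    · rw [isGE_iff]
      intro i hi
      refine isZero_of_exact (HomologySequence.exact₃ _ hT i (i + 1) rfl) ?_ ?_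
      · exact (hX'' i (by omega)).eq_of_src _ _
      · exact (hP'' (i + 1) (by omega)).eq_of_tgt _ _
    · intro M n hn u
      obtain ⟨u', rfl⟩ := Triangle.yoneda_exact₃ _ hT u (hV M n hn _)
      let i := ((singleFunctors A).shiftIso (1 : ℤ) (b - 1) b (by omega)).app P
      have : i.inv ≫ u' = 0 := hom_single_proj P M (b - 1) n (by omega) _
      have : u' = 0 := (cancel_epi i.inv).1 (this.trans comp_zero.symm)
      rw [this]
      exact comp_zero

lemma van_ses {X : DerivedCategory A} {S : ShortComplex A} (hS : S.ShortExact) (n : ℤ)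
    (h₁ : ∀ f : X ⟶ (singleFunctor A n).obj S.X₁, f = 0)
    (h₃ : ∀ f : X ⟶ (singleFunctor A n).obj S.X₃, f = 0)
    (f : X ⟶ (singleFunctor A n).obj S.X₂) : f = 0 := by
  obtain ⟨δ, hδ⟩ := exists_single_triangle hS n
  obtain ⟨g, hg⟩ := Triangle.coyoneda_exact₂ _ hδ f (h₃ _)
  rw [hg, h₁ g]
  exact zero_comp

lemma van_iso {X : DerivedCategory A} {M M' : A} (e : M ≅ M') (n : ℤ)
    (h : ∀ f : X ⟶ (singleFunctor A n).obj M, f = 0)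
    (f : X ⟶ (singleFunctor A n).obj M') : f = 0 :=
  (cancel_mono ((singleFunctor A n).mapIso e.symm).hom).1 ((h _).trans zero_comp.symm)

lemma van_zero {X : DerivedCategory A} {M : A} (hM : IsZero M) (n : ℤ)
    (f : X ⟶ (singleFunctor A n).obj M) : f = 0 :=
  ((singleFunctor A n).map_isZero hM).eq_of_tgt _ _

end PerfAux

open PerfAux DerivedCategory in
/-- Let `𝒜` be an abelian category with enough projectives which is finitely
filtrated: there are finitely many objects `S_1, …, S_m` such that every nonzero object `X`
has a finite filtration `0 = X_0 ↪ X_1 ↪ ⋯ ↪ X_n = X` whose successive quotients (cokernels)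
are isomorphic to some `S_j`.  Then every perfect object of `D^b(𝒜)` lies in `K^b(𝒫)`:
if `P` is a bounded cochain complex such that for each bounded cochain complex `Y` only
finitely many `i` admit a nonzero map `P ⟶ Y[i]` in the derived category, then `P` is
isomorphic in the derived category to a bounded complex of projectives. -/
theorem stmt_10 {𝒜 : Type u} [Category.{v} 𝒜] [Abelian 𝒜] [EnoughProjectives 𝒜]
    [HasDerivedCategory.{w} 𝒜]
    (hfilt : ∃ (m : ℕ) (S : Fin m → 𝒜), ∀ X : 𝒜, ¬ IsZero X →
      ∃ (n : ℕ) (F : Fin (n + 1) → 𝒜) (f : ∀ i : Fin n, F i.castSucc ⟶ F i.succ),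
        IsZero (F 0) ∧ Nonempty (F (Fin.last n) ≅ X) ∧
        ∀ i : Fin n, Mono (f i) ∧ ∃ j : Fin m, Nonempty (cokernel (f i) ≅ S j))
    (P : CochainComplex 𝒜 ℤ)
    (hPbdd : ∃ a b : ℤ, ∀ n : ℤ, (n < a ∨ b < n) → IsZero (P.X n))
    (hperf : ∀ Y : CochainComplex 𝒜 ℤ,
      (∃ a b : ℤ, ∀ n : ℤ, (n < a ∨ b < n) → IsZero (Y.X n)) →
      {i : ℤ | ∃ f : DerivedCategory.Q.obj P ⟶ (DerivedCategory.Q.obj Y)⟦i⟧,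
        f ≠ 0}.Finite) :
    ∃ Pb : CochainComplex 𝒜 ℤ,
      (∃ a b : ℤ, ∀ n : ℤ, (n < a ∨ b < n) → IsZero (Pb.X n)) ∧
      (∀ n : ℤ, Projective (Pb.X n)) ∧
      Nonempty (DerivedCategory.Q.obj P ≅ DerivedCategory.Q.obj Pb) := by
  obtain ⟨m, S, hS⟩ := hfilt
  obtain ⟨a, b, hab⟩ := hPbdd
  have hle : P.IsStrictlyLE b := by
    rw [CochainComplex.isStrictlyLE_iff]
    exact fun i hi => hab i (Or.inr hi)
  have hge : P.IsStrictlyGE a := by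
    rw [CochainComplex.isStrictlyGE_iff]
    exact fun i hi => hab i (Or.inl hi)
  have hfin : ∀ j : Fin m, ∃ B : ℤ, ∀ n : ℤ, n ≤ B →
      ∀ f : Q.obj P ⟶ (singleFunctor 𝒜 n).obj (S j), f = 0 := by
    intro j
    obtain ⟨B, hB⟩ := (hperf _ (single_bdd (S j) 0)).bddAbove
    refine ⟨-B - 1, fun n hn f => ?_⟩
    by_contra hf
    let i := ((singleFunctors 𝒜).shiftIso (-n) n 0 (by omega)).app (S j)
    have := hB (show -n ∈ _ from ⟨f ≫ i.inv, fun h => hf ?_⟩)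
    · omega
    · exact (cancel_mono i.inv).1 (h.trans zero_comp.symm)
  choose B hB using hfin
  obtain ⟨N, hN⟩ := (Set.finite_range B).bddBelow
  have hV : Van (Q.obj P) (min N (min a b - 1)) := by
    intro M n hn f
    by_cases hM : IsZero M
    · exact van_zero hM n f
    obtain ⟨l, F, φ, h0, ⟨e⟩, hφ⟩ := hS M hM
    have key : ∀ k : Fin (l + 1), ∀ g : Q.obj P ⟶ (singleFunctor 𝒜 n).obj (F k), g = 0 := by
      intro k
      induction k using Fin.induction with
      | zero => exact van_zero h0 n
      | succ i ih =>
        obtain ⟨hmono, j, ⟨e'⟩⟩ := hφ i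
        have hSES : (ShortComplex.mk (φ i) (cokernel.π (φ i)) (by simp)).ShortExact :=
          { exact := ShortComplex.exact_of_g_is_cokernel _ (cokernelIsCokernel _)
            mono_f := hmono
            epi_g := by dsimp; infer_instance }
        refine van_ses hSES n ih (van_iso e'.symm n (hB j n ?_))
        have := hN ⟨j, rfl⟩
        omega
    exact van_iso e n (key _) f
  have hLE : (Q.obj P).IsLE b := inferInstance
  have hGE : (Q.obj P).IsGE (min a b) := by
    have h1 : (Q.obj P).IsGE a := inferInstance
    rw [isGE_iff] at h1 ⊢
    exact fun i hi => h1 i (by omega)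
  exact main_aux (min a b) (min N (min a b - 1)) (by omega)
    (b - (min N (min a b - 1) + 1)).toNat (Q.obj P) b (by omega) hLE
    (by rwa [show min (min a b) b = min a b by omega]) hV
end

section
/- (Buchweitz's criterion) Let 𝒜 be an abelian category with enough projectives and P ∈ D^b(𝒜). Then P lies in K^b(𝒫) if and only if there exists a finite set I(P) ⊆ ℤ such that Hom_{D^b(𝒜)}(P, M[j]) = 0 for every j ∉ I(P) and every object M ∈ 𝒜. -/
open CategoryTheory CategoryTheory.Limits

universe w v u

namespace Buchweitz

open Opposite CochainComplex

lemma eq_zero_of_iso {D : Type*} [Category D] [HasZeroMorphisms D] {X X' Y Y' : D}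
    (e : X' ≅ X) (e' : Y ≅ Y') (f : X ⟶ Y) (h : e.hom ≫ f ≫ e'.hom = 0) : f = 0 := by
  rw [← cancel_epi e.hom, ← cancel_mono e'.hom, Category.assoc, h]
  simp

lemma quasiIso_of_op {C : Type*} [Category C] [Abelian C] {K L : CochainComplex C ℤ} (g : K ⟶ L)
    (h : QuasiIso ((opEquivalence C).functor.map g.op)) : QuasiIso g := by
  refine ⟨fun n => ?_⟩
  obtain ⟨m, rfl⟩ : ∃ m : ℤ, n = -m := ⟨-n, by simp⟩
  have h1 : QuasiIsoAt ((opEquivalence C).functor.map g.op) m := inferInstance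
  rw [quasiIsoAt_iff' _ (m - 1) m (m + 1) (by simp) (by simp)] at h1
  rw [quasiIsoAt_iff' _ (-(m + 1)) (-m) (-(m - 1)) (by simp; lia) (by simp; lia),
    ← ShortComplex.quasiIso_opMap_iff]
  exact h1

lemma exists_projective_resolution {C : Type*} [Category C] [Abelian C] [EnoughProjectives C]
    (K : CochainComplex C ℤ) (b : ℤ) [K.IsStrictlyLE b] :
    ∃ (L : CochainComplex C ℤ) (p : L ⟶ K), QuasiIso p ∧ (∀ n, Projective (L.X n)) ∧
      L.IsStrictlyLE b := by
  have : ((opEquivalence C).functor.obj (op K)).IsStrictlyGE (-b) := by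
    rw [isStrictlyGE_iff]
    intro i hi
    exact (K.isZero_of_isStrictlyLE b (-i) (by lia)).op
  obtain ⟨J, i, hi, hJ, hJ'⟩ :=
    CochainComplex.Plus.modelCategoryQuillen.exists_quasiIso_injective ((opEquivalence C).functor.obj (op K)) (-b)
  let L := ((opEquivalence C).functor.objPreimage J).unop
  let e : (opEquivalence C).functor.obj (op L) ≅ J := (opEquivalence C).functor.objObjPreimageIso J
  obtain ⟨g, hg⟩ := (opEquivalence C).functor.map_surjective (i ≫ e.inv)
  have eX (n : ℤ) : op (L.X (-n)) ≅ J.X n :=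
    (HomologicalComplex.eval _ _ n).mapIso e
  refine ⟨L, g.unop, quasiIso_of_op _ ?_, fun n => ?_, ?_⟩
  · rw [Quiver.Hom.op_unop, hg]
    infer_instance
  · obtain ⟨m, rfl⟩ : ∃ m : ℤ, n = -m := ⟨-n, by simp⟩
    rw [Injective.projective_iff_injective_op]
    exact Injective.of_iso (eX m).symm (hJ m)
  · rw [isStrictlyLE_iff]
    intro n hn
    obtain ⟨m, rfl⟩ : ∃ m : ℤ, n = -m := ⟨-n, by simp⟩
    exact ((J.isZero_of_isStrictlyGE (-b) m (by lia)).of_iso (eX m)).unop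

section

variable {C : Type u} [Category.{v} C] [Abelian C] [HasDerivedCategory.{w} C]

noncomputable def shiftIso (M : C) (j n : ℤ) (h : j + n = 0) :
    ((DerivedCategory.singleFunctor C 0).obj M)⟦j⟧ ≅
      DerivedCategory.Q.obj ((HomologicalComplex.single C (.up ℤ) n).obj M) :=
  ((DerivedCategory.singleFunctors C).shiftIso j n 0 h).app M

lemma eq_map (K L : CochainComplex C ℤ) [K.IsKProjective]
    (f : DerivedCategory.Q.obj K ⟶ DerivedCategory.Q.obj L) :
    ∃ g : K ⟶ L, DerivedCategory.Q.map g = f := by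
  obtain ⟨g, hg⟩ := (IsKProjective.Qh_map_bijective K
    ((HomotopyCategory.quotient _ _).obj L)).surjective
    ((DerivedCategory.quotientCompQhIso C).hom.app K ≫ f ≫
      (DerivedCategory.quotientCompQhIso C).inv.app L)
  obtain ⟨g, rfl⟩ := (HomotopyCategory.quotient _ _).map_surjective g
  refine ⟨g, ?_⟩
  have := (DerivedCategory.quotientCompQhIso C).hom.naturality g
  rw [← cancel_epi ((DerivedCategory.quotientCompQhIso C).hom.app K), ← this]
  rw [Functor.comp_map, hg]
  simp

lemma nonempty_homotopy (K L : CochainComplex C ℤ) [K.IsKProjective]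
    (g : K ⟶ L) (h : DerivedCategory.Q.map g = 0) : Nonempty (Homotopy g 0) := by
  rw [← HomotopyCategory.quotient_map_eq_zero_iff]
  apply (IsKProjective.Qh_map_bijective K _).injective
  rw [Functor.map_zero]
  have := (DerivedCategory.quotientCompQhIso C).hom.naturality g
  rw [h, comp_zero] at this
  exact (cancel_mono _).1 (this.trans zero_comp.symm)

lemma projective_opcycles (L : CochainComplex C ℤ) [L.IsKProjective] (n : ℤ)
    [Projective (L.X (n + 1))]
    (h : ∀ (f : DerivedCategory.Q.obj L ⟶
      DerivedCategory.Q.obj ((HomologicalComplex.single C (.up ℤ) n).obj (L.opcycles n))), f = 0) :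
    Projective (L.opcycles n) := by
  let g : L ⟶ (HomologicalComplex.single C (.up ℤ) n).obj (L.opcycles n) :=
    HomologicalComplex.mkHomToSingle (L.pOpcycles n) (fun i _ => L.d_pOpcycles i n)
  obtain ⟨H⟩ := nonempty_homotopy _ _ g (h _)
  have hc := H.comm n
  rw [HomologicalComplex.mkHomToSingle_f, dNext_eq _ (i' := n + 1) (by simp),
    prevD_eq _ (j' := n - 1) (by simp), HomologicalComplex.single_obj_d, comp_zero,
    add_zero, HomologicalComplex.zero_f, add_zero] at hc
  refine Retract.projective (Y := L.X (n + 1)) ⟨L.fromOpcycles n (n + 1),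
    H.hom (n + 1) n ≫ (HomologicalComplex.singleObjXSelf (.up ℤ) n (L.opcycles n)).hom, ?_⟩
  rw [← cancel_epi (L.pOpcycles n), HomologicalComplex.p_fromOpcycles_assoc, ← Category.assoc,
    ← hc]
  simp

end

end Buchweitz

open Buchweitz CochainComplex in
/-- Buchweitz's criterion: Let `𝒜` be an abelian category with enough
projectives and `P` an object of `D^b(𝒜)` (a bounded cochain complex viewed in the derived
category).  Then `P` lies in `K^b(𝒫)` (i.e. is isomorphic in the derived category to a
bounded complex of projectives) if and only if there is a finite set `I(P) ⊆ ℤ` such that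
`Hom_{D(𝒜)}(P, M[j]) = 0` for every `j ∉ I(P)` and every object `M ∈ 𝒜` (viewed as a stalk
complex in degree `0`). -/
theorem stmt_11 {𝒜 : Type u} [Category.{v} 𝒜] [Abelian 𝒜] [EnoughProjectives 𝒜]
    [HasDerivedCategory.{w} 𝒜]
    (P : CochainComplex 𝒜 ℤ)
    (hPbdd : ∃ a b : ℤ, ∀ n : ℤ, (n < a ∨ b < n) → IsZero (P.X n)) :
    (∃ Pb : CochainComplex 𝒜 ℤ,
      (∃ a b : ℤ, ∀ n : ℤ, (n < a ∨ b < n) → IsZero (Pb.X n)) ∧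
      (∀ n : ℤ, Projective (Pb.X n)) ∧
      Nonempty (DerivedCategory.Q.obj P ≅ DerivedCategory.Q.obj Pb)) ↔
    (∃ I : Finset ℤ, ∀ j : ℤ, j ∉ I → ∀ (M : 𝒜)
      (f : DerivedCategory.Q.obj P ⟶ ((DerivedCategory.singleFunctor 𝒜 0).obj M)⟦j⟧),
      f = 0) := by
  constructor
  · rintro ⟨Pb, ⟨a, b, hab⟩, hproj, ⟨e⟩⟩
    have : Pb.IsStrictlyLE b := by
      rw [isStrictlyLE_iff]
      exact fun i hi => hab i (Or.inr hi)
    have : Pb.IsKProjective := isKProjective_of_projective Pb b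
    refine ⟨Finset.Icc (-b) (-a), fun j hj M f => ?_⟩
    have hj' : -j < a ∨ b < -j := by
      rw [Finset.mem_Icc] at hj
      lia
    obtain ⟨g, hg⟩ := eq_map _ _ (e.inv ≫ f ≫ (shiftIso M j (-j) (by simp)).hom)
    have hg0 : g = 0 := HomologicalComplex.to_single_hom_ext ((hab _ hj').eq_of_src _ _)
    rw [hg0, Functor.map_zero] at hg
    exact eq_zero_of_iso e.symm (shiftIso M j (-j) (by simp)) f hg.symm
  · rintro ⟨I, hI⟩
    obtain ⟨a, b, hab⟩ := hPbdd
    have : P.IsStrictlyLE b := by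
      rw [isStrictlyLE_iff]
      exact fun i hi => hab i (Or.inr hi)
    have hGE : P.IsStrictlyGE a := by
      rw [isStrictlyGE_iff]
      exact fun i hi => hab i (Or.inl hi)
    obtain ⟨L, p, hp, hproj, hL⟩ := exists_projective_resolution P b
    have : L.IsKProjective := isKProjective_of_projective L b
    obtain ⟨B, hB⟩ := I.bddAbove
    obtain ⟨n, hna, hnI⟩ : ∃ n : ℤ, n ≤ a ∧ -n ∉ I := by
      refine ⟨min a (-B - 1), min_le_left _ _, fun h => ?_⟩
      have := hB h
      have := min_le_right a (-B - 1)
      lia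
    have e := asIso (DerivedCategory.Q.map p)
    have : P.IsStrictlyGE n := P.isStrictlyGE_of_ge n a hna
    have : L.IsGE n := by
      have hK : P.IsGE n := inferInstance
      rw [← DerivedCategory.isGE_Q_obj_iff] at hK ⊢
      exact DerivedCategory.TStructure.t.isGE_of_iso e.symm n
    have hop : Projective (L.opcycles n) := by
      have := hproj (n + 1)
      refine projective_opcycles L n fun f => ?_
      exact eq_zero_of_iso e.symm (shiftIso (L.opcycles n) (-n) n (by simp)).symm f (hI (-n) hnI _ _)
    refine ⟨L.truncGE n, ⟨n, b, fun i hi => ?_⟩, fun q => ?_,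
      ⟨e.symm ≪≫ asIso (DerivedCategory.Q.map (L.πTruncGE n))⟩⟩
    · obtain hi | hi := hi
      · exact (L.truncGE n).isZero_of_isStrictlyGE n i hi
      · exact (L.truncGE n).isZero_of_isStrictlyLE b i hi
    · obtain h | rfl | h := lt_trichotomy q n
      · exact ((L.truncGE n).isZero_of_isStrictlyGE n q h).projective
      · exact Projective.of_iso (L.truncGEXIsoOpcycles q).symm hop
      · exact Projective.of_iso (L.truncGEXIso n q h).symm (hproj q)
end

section
/- Let A be an Artin algebra, T a cotilting A-module, and X ∈ mod A. Then X is cogenerated by T (i.e., X embeds into a finite direct sum of copies of T) if and only if Ext^i_A(X, T) = 0 for all i ≥ 1. -/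
open CategoryTheory CategoryTheory.Limits

universe u

section Helpers

variable {B : Type u} [Ring B] [HasExt.{u} (ModuleCat.{u} B)]

/-- Vanishing of `Ext^2(-, Y)` implies vanishing of all higher `Ext(-, Y)`. -/
lemma ext_vanish_ge_two (Y : ModuleCat.{u} B)
    (h : ∀ X : ModuleCat.{u} B, Subsingleton (Abelian.Ext X Y 2)) (n : ℕ) :
    ∀ X : ModuleCat.{u} B, Subsingleton (Abelian.Ext X Y (n + 2)) := by
  induction n with
  | zero => exact h
  | succ n ih =>
    intro X
    refine subsingleton_of_forall_eq 0 fun e => ?_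
    let g : Projective.over X ⟶ X := Projective.π X
    let S : ShortComplex (ModuleCat.{u} B) :=
      ShortComplex.mk (kernel.ι g) g (kernel.condition g)
    have hS : S.ShortExact :=
      { exact := ShortComplex.exact_kernel g
        mono_f := inferInstanceAs (Mono (kernel.ι g))
        epi_g := inferInstanceAs (Epi (Projective.π X)) }
    have hP : Projective S.X₂ := inferInstanceAs (Projective (Projective.over X))
    obtain ⟨x, hx⟩ := Abelian.Ext.contravariant_sequence_exact₃ hS Y (n₁ := n + 2 + 1) e
      (Abelian.Ext.eq_zero_of_projective _) (n₀ := n + 2) (by omega)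
    have hx0 : x = 0 := (ih S.X₁).elim _ _
    rw [← hx, hx0, Abelian.Ext.comp_zero]

/-- The identity of a retract of `T^n` decomposes as a finite sum of maps through `T`. -/
lemma retract_sum (T : Type u) [AddCommGroup T] [Module B T] (Y : ModuleCat.{u} B) (n : ℕ)
    (f : Y →ₗ[B] (Fin n → T)) (g : (Fin n → T) →ₗ[B] Y) (hgf : g ∘ₗ f = LinearMap.id) :
    ∃ (p : Fin n → (Y ⟶ ModuleCat.of B T)) (q : Fin n → (ModuleCat.of B T ⟶ Y)),
      𝟙 Y = ∑ i, p i ≫ q i := by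
  refine ⟨fun i => ModuleCat.ofHom (LinearMap.proj i ∘ₗ f),
    fun i => ModuleCat.ofHom (g ∘ₗ LinearMap.single B (fun _ => T) i), ?_⟩
  ext y
  have h1 : g (f y) = y := LinearMap.congr_fun hgf y
  have h2 : f y = ∑ i, Pi.single i (f y i) := (Finset.univ_sum_single (f y)).symm
  simp only [ModuleCat.hom_sum, LinearMap.sum_apply]
  change y = ∑ i, g (Pi.single i (f y i))
  rw [← map_sum, ← h2, h1]

lemma ext_retract_right (T : Type u) [AddCommGroup T] [Module B T] (X Y : ModuleCat.{u} B) (n : ℕ)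
    (f : Y →ₗ[B] (Fin n → T)) (g : (Fin n → T) →ₗ[B] Y) (hgf : g ∘ₗ f = LinearMap.id)
    (k : ℕ) (h : Subsingleton (Abelian.Ext X (ModuleCat.of B T) k)) (e : Abelian.Ext X Y k) :
    e = 0 := by
  obtain ⟨p, q, hpq⟩ := retract_sum T Y n f g hgf
  rw [← e.comp_mk₀_id, hpq, Abelian.Ext.mk₀_sum, Abelian.Ext.comp_sum]
  refine Finset.sum_eq_zero fun i _ => ?_
  rw [← Abelian.Ext.mk₀_comp_mk₀, ← Abelian.Ext.comp_assoc_of_third_deg_zero,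
    h.elim (e.comp (Abelian.Ext.mk₀ (p i)) (add_zero k)) 0, Abelian.Ext.zero_comp]

lemma ext_retract_left (T : Type u) [AddCommGroup T] [Module B T] (X Y : ModuleCat.{u} B) (n : ℕ)
    (f : Y →ₗ[B] (Fin n → T)) (g : (Fin n → T) →ₗ[B] Y) (hgf : g ∘ₗ f = LinearMap.id)
    (k : ℕ) (h : Subsingleton (Abelian.Ext (ModuleCat.of B T) X k)) (e : Abelian.Ext Y X k) :
    e = 0 := by
  obtain ⟨p, q, hpq⟩ := retract_sum T Y n f g hgf
  rw [← e.mk₀_id_comp, hpq, Abelian.Ext.mk₀_sum, Abelian.Ext.sum_comp]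
  refine Finset.sum_eq_zero fun i _ => ?_
  rw [← Abelian.Ext.mk₀_comp_mk₀_assoc,
    h.elim ((Abelian.Ext.mk₀ (q i)).comp e (zero_add k)) 0, Abelian.Ext.comp_zero]

end Helpers

/-- Let `A` be an Artin algebra and `T` a cotilting (right) `A`-module:
`inj.dim T ≤ 1`, `Ext^1_A(T,T) = 0`, and there is a short exact sequence
`0 → T_0 → T_1 → D(A_A) → 0` with `T_0, T_1 ∈ add T`, where `D(A_A)` is the minimal
injective cogenerator of `mod A` (encoded here as a finitely generated injective module `DA`
into finite direct sums of which every finitely generated module embeds).  Then a finitely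
generated right `A`-module `X` is cogenerated by `T` (embeds into a finite direct sum of
copies of `T`) if and only if `Ext^i_A(X, T) = 0` for all `i ≥ 1`. -/
theorem stmt_14
    (R : Type u) [CommRing R] [IsArtinianRing R]
    (A : Type u) [Ring A] [Algebra R A] [Module.Finite R A]
    [HasExt.{u} (ModuleCat.{u} Aᵐᵒᵖ)]
    (T : Type u) [AddCommGroup T] [Module Aᵐᵒᵖ T] [Module.Finite Aᵐᵒᵖ T]
    -- the minimal injective cogenerator `D(A_A)` of `mod A` :
    (DA : Type u) [AddCommGroup DA] [Module Aᵐᵒᵖ DA] [Module.Finite Aᵐᵒᵖ DA]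
    (hDAinj : Module.Injective Aᵐᵒᵖ DA)
    (hDAcogen : ∀ (X : Type u) [AddCommGroup X] [Module Aᵐᵒᵖ X], Module.Finite Aᵐᵒᵖ X →
      ∃ (n : ℕ) (ι : X →ₗ[Aᵐᵒᵖ] (Fin n → DA)), Function.Injective ι)
    -- `inj.dim T ≤ 1` :
    (hid : ∀ X : ModuleCat.{u} Aᵐᵒᵖ, Subsingleton (Abelian.Ext X (ModuleCat.of Aᵐᵒᵖ T) 2))
    -- `Ext^1_A(T, T) = 0` :
    (hself : Subsingleton (Abelian.Ext (ModuleCat.of Aᵐᵒᵖ T) (ModuleCat.of Aᵐᵒᵖ T) 1))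
    -- the exact sequence `0 → T_0 → T_1 → D(A_A) → 0` with `T_0, T_1 ∈ add T` :
    (hses : ∃ S : ShortComplex (ModuleCat.{u} Aᵐᵒᵖ), S.ShortExact ∧
      (∃ (n : ℕ) (f : S.X₁ →ₗ[Aᵐᵒᵖ] (Fin n → T)) (g : (Fin n → T) →ₗ[Aᵐᵒᵖ] S.X₁),
        g ∘ₗ f = LinearMap.id) ∧
      (∃ (n : ℕ) (f : S.X₂ →ₗ[Aᵐᵒᵖ] (Fin n → T)) (g : (Fin n → T) →ₗ[Aᵐᵒᵖ] S.X₂),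
        g ∘ₗ f = LinearMap.id) ∧
      Nonempty (S.X₃ ≅ ModuleCat.of Aᵐᵒᵖ DA)) :
    ∀ (X : ModuleCat.{u} Aᵐᵒᵖ), Module.Finite Aᵐᵒᵖ X →
      ((∃ (n : ℕ) (ι : X →ₗ[Aᵐᵒᵖ] (Fin n → T)), Function.Injective ι) ↔
        (∀ i : ℕ, 1 ≤ i → Subsingleton (Abelian.Ext X (ModuleCat.of Aᵐᵒᵖ T) i))) := by
  intro X hX
  constructor
  · rintro ⟨n, ι, hι⟩ i hi
    obtain ⟨i, rfl⟩ | rfl : (∃ j, i = j + 2) ∨ i = 1 := by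
      rcases Nat.lt_or_ge i 2 with h | h
      · right; omega
      · left; exact ⟨i - 2, by omega⟩
    · exact ext_vanish_ge_two _ hid i X
    · refine subsingleton_of_forall_eq 0 fun e => ?_
      let f : X ⟶ ModuleCat.of Aᵐᵒᵖ (Fin n → T) := ModuleCat.ofHom ι
      have hf : Mono f := (ModuleCat.mono_iff_injective f).2 hι
      let S : ShortComplex (ModuleCat.{u} Aᵐᵒᵖ) :=
        ShortComplex.mk f (cokernel.π f) (cokernel.condition f)
      have hS : S.ShortExact :=
        { exact := ShortComplex.exact_cokernel f
          mono_f := hf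
          epi_g := inferInstanceAs (Epi (cokernel.π f)) }
      obtain ⟨x, hx⟩ := Abelian.Ext.contravariant_sequence_exact₁ hS
        (ModuleCat.of Aᵐᵒᵖ T) e (n₁ := 2) rfl ((hid _).elim _ _)
      have hx0 : x = 0 := ext_retract_left T _ S.X₂ n LinearMap.id LinearMap.id rfl 1 hself x
      rw [← hx, hx0, Abelian.Ext.comp_zero]
  · intro h
    obtain ⟨S, hS, ⟨n₀, f₀, g₀, h₀⟩, ⟨n₁, f₁, g₁, h₁⟩, ⟨φ⟩⟩ := hses
    obtain ⟨n, ι, hι⟩ := hDAcogen X hX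
    have lift : ∀ i : Fin n, ∃ l : X ⟶ S.X₂,
        l ≫ S.g ≫ φ.hom = ModuleCat.ofHom (LinearMap.proj i ∘ₗ ι) := by
      intro i
      obtain ⟨x, hx⟩ := Abelian.Ext.covariant_sequence_exact₃ X hS
        (Abelian.Ext.mk₀ (ModuleCat.ofHom (LinearMap.proj i ∘ₗ ι) ≫ φ.inv)) (n₁ := 1) rfl
        (ext_retract_right T X S.X₁ n₀ f₀ g₀ h₀ 1 (h 1 le_rfl) _)
      obtain ⟨l, rfl⟩ := (Abelian.Ext.mk₀_bijective X S.X₂).2 x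
      rw [Abelian.Ext.mk₀_comp_mk₀] at hx
      have := (Abelian.Ext.mk₀_bijective _ _).1 hx
      refine ⟨l, ?_⟩
      rw [← Category.assoc, this, Category.assoc, φ.inv_hom_id, Category.comp_id]
    choose l hl using lift
    refine ⟨n * n₁, LinearMap.pi fun k =>
      LinearMap.proj (finProdFinEquiv.symm k).2 ∘ₗ f₁ ∘ₗ (l (finProdFinEquiv.symm k).1).hom, ?_⟩
    intro x y hxy
    apply hι
    funext i
    have key : (l i).hom x = (l i).hom y := by
      have hinj : Function.Injective f₁ :=
        Function.LeftInverse.injective (g := g₁) fun z => LinearMap.congr_fun h₁ z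
      apply hinj
      funext j
      have := congrFun hxy (finProdFinEquiv (i, j))
      simp only [LinearMap.pi_apply, LinearMap.comp_apply, Equiv.symm_apply_apply,
        LinearMap.proj_apply] at this
      exact this
    have hx := congrArg (fun m => m.hom x) (hl i)
    have hy := congrArg (fun m => m.hom y) (hl i)
    change φ.hom.hom (S.g.hom ((l i).hom x)) = ι x i at hx
    change φ.hom.hom (S.g.hom ((l i).hom y)) = ι y i at hy
    rw [← hx, ← hy, key]
end
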